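/- Let H be a separable Hilbert space and let X be a centered Gaussian random vector in H with infinite-dimensional Cameron–Martin space. Assume the ordered nonzero eigenvalues of the covariance operator satisfy λ_j ~ φ(j) as j → ∞, where φ : (s,∞) → (0,∞) is a decreasing function, regularly varying at infinity of index −b for some b > 1 and some s ≥ 0. Let U_X be the closed unit ball of the Cameron–Martin space, i.e. U_X = {x ∈ supp(P_X) : Σ_{j≥1} ⟨x,u_j⟩²/λ_j ≤ 1} where {u_j} is an orthonormal basis of eigenvectors for the eigenvalues λ_j. Then the entropy numbers satisfy e_n(U_X) ~ (b/2)^{b/2} · φ(log n)^{1/2} as n → ∞. -/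

import Mathlib

open MeasureTheory ProbabilityTheory Filter Real
open scoped RealInnerProductSpace NNReal

/-- The `n`-th (Kolmogorov) entropy number of a subset `K` of `H`:
`e_n(K) = inf { sup_{x ∈ K} min_{a ∈ α} ‖x - a‖ : α ⊆ H, card α ≤ n }`. -/
noncomputable def entropyNum {H : Type*} [NormedAddCommGroup H] (K : Set H) (n : ℕ) : ℝ :=
  sInf { r : ℝ | ∃ α : Finset H, α.Nonempty ∧ α.card ≤ n ∧
    r = sSup ((fun x => sInf ((fun a => ‖x - a‖) '' (α : Set H))) '' K) }

section BallCovering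

theorem exists_finset_fewer_uncovered {E : Type*} [NormedAddCommGroup E] [MeasurableSpace E]
    [BorelSpace E] (μ : Measure E) {A : Set E} (hA0 : μ A ≠ 0)
    (hA : μ A ≠ ⊤) {p r : ℝ} (hp1 : p ≤ 1) (F : Finset E)
    (hF : ∀ x ∈ F, p * μ.real A ≤ μ.real (Metric.closedBall x r ∩ A)) (N : ℕ) :
    ∃ T : Finset E, T.card ≤ N ∧ ∃ G ⊆ F, (∀ x ∈ F, x ∉ G → ∃ c ∈ T, ‖x - c‖ ≤ r) ∧
      (G.card : ℝ) ≤ (1 - p) ^ N * F.card := by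
  classical
  induction N with
  | zero => exact ⟨∅, by simp, F, subset_rfl, fun x hx h => absurd hx h, by simp⟩
  | succ N ih =>
    obtain ⟨T, hT, G, hGF, hcov, hcard⟩ := ih
    have hfin : ∀ x : E, μ.restrict A (Metric.closedBall x r) ≠ ⊤ := fun x =>
      (((measure_mono (Set.subset_univ _)).trans_eq (Measure.restrict_apply_univ _)).trans_lt
        hA.lt_top).ne
    have hint : ∀ x ∈ G, IntegrableOn ((Metric.closedBall x r).indicator fun _ => (1 : ℝ)) A μ :=
      fun x _ => (integrable_indicator_iff Metric.isClosed_closedBall.measurableSet).2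
        (integrableOn_const (hfin x))
    obtain ⟨c, -, hc⟩ := exists_setAverage_le hA0 hA (integrable_finsetSum G hint)
    have hApos : 0 < μ.real A := ENNReal.toReal_pos hA0 hA
    have hcount : p * G.card ≤ ((G.filter fun x => ‖x - c‖ ≤ r).card : ℝ) := by
      have h1 : (∑ x ∈ G, (Metric.closedBall x r).indicator (fun _ => (1 : ℝ)) c) =
          ((G.filter fun x => ‖x - c‖ ≤ r).card : ℝ) := by
        rw [Finset.card_filter, Nat.cast_sum]
        refine Finset.sum_congr rfl fun x _ => ?_
        simp only [Set.indicator_apply, mem_closedBall_iff_norm, norm_sub_rev c x]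
        split_ifs <;> simp
      have h2 : p * G.card ≤
          ⨍ a in A, ∑ x ∈ G, (Metric.closedBall x r).indicator (fun _ => (1 : ℝ)) a ∂μ := by
        rw [setAverage_eq, integral_finsetSum G hint, smul_eq_mul, inv_mul_eq_div,
          le_div_iff₀ hApos]
        have h3 : ∀ x ∈ G, p * μ.real A ≤
            ∫ a in A, (Metric.closedBall x r).indicator (fun _ => (1 : ℝ)) a ∂μ := by
          intro x hx
          rw [integral_indicator Metric.isClosed_closedBall.measurableSet, setIntegral_const,
            smul_eq_mul, mul_one, measureReal_restrict_apply
              Metric.isClosed_closedBall.measurableSet]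
          exact hF x (hGF hx)
        calc p * G.card * μ.real A = ∑ x ∈ G, p * μ.real A := by
              rw [Finset.sum_const, nsmul_eq_mul]; ring
          _ ≤ _ := Finset.sum_le_sum h3
      linarith
    refine ⟨insert c T, (Finset.card_insert_le _ _).trans (by omega),
      G.filter fun x => ¬ ‖x - c‖ ≤ r, (Finset.filter_subset _ _).trans hGF, ?_, ?_⟩
    · intro x hx hxG
      by_cases hxG' : x ∈ G
      · refine ⟨c, Finset.mem_insert_self _ _, ?_⟩
        by_contra h
        exact hxG (Finset.mem_filter.2 ⟨hxG', h⟩)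
      · obtain ⟨c', hc', h⟩ := hcov x hx hxG'
        exact ⟨c', Finset.mem_insert_of_mem hc', h⟩
    · have h1 := Finset.card_filter_add_card_filter_not (s := G) (fun x => ‖x - c‖ ≤ r)
      have h2 : ((G.filter fun x => ‖x - c‖ ≤ r).card : ℝ) +
          (G.filter fun x => ¬ ‖x - c‖ ≤ r).card = G.card := by exact_mod_cast h1
      have h3 := mul_le_mul_of_nonneg_left hcard (sub_nonneg.2 hp1)
      rw [pow_succ]
      nlinarith

variable {E : Type*} [NormedAddCommGroup E] [InnerProductSpace ℝ E] [FiniteDimensional ℝ E]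

theorem card_le_of_separated_of_norm_le [MeasurableSpace E] [BorelSpace E] {R t : ℝ} (hR : 0 ≤ R)
    (ht : 0 < t) (F : Finset E)
    (hF : ∀ x ∈ F, ‖x‖ ≤ R) (hsep : ∀ x ∈ F, ∀ y ∈ F, x ≠ y → t ≤ ‖x - y‖) :
    (F.card : ℝ) ≤ (1 + 2 * R / t) ^ Module.finrank ℝ E := by
  let μ : Measure E := Measure.addHaar
  have D : Set.Pairwise (F : Set E)
      (Function.onFun Disjoint fun c => Metric.ball (c : E) (t / 2)) := by
    rintro c hc d hd hcd
    apply Metric.ball_disjoint_ball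
    rw [dist_eq_norm]
    linarith [hsep c hc d hd hcd]
  have hsub : (⋃ c ∈ F, Metric.ball (c : E) (t / 2)) ⊆ Metric.ball (0 : E) (R + t / 2) := by
    refine Set.iUnion₂_subset fun x hx => Metric.ball_subset_ball' ?_
    rw [dist_zero_right]
    linarith [hF x hx]
  have hμ : 0 < μ.real (Metric.ball (0 : E) 1) :=
    ENNReal.toReal_pos (Metric.measure_ball_pos _ _ zero_lt_one).ne' measure_ball_lt_top.ne
  have hle := measureReal_mono (μ := μ) hsub measure_ball_lt_top.ne
  rw [measureReal_biUnion_finset D (fun c _ => measurableSet_ball)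
    (fun _ _ => measure_ball_lt_top.ne)] at hle
  simp only [measureReal_def, μ.addHaar_ball_of_pos _ (half_pos ht),
    μ.addHaar_ball_of_pos _ (show 0 < R + t / 2 by positivity), Finset.sum_const, nsmul_eq_mul,
    ENNReal.toReal_mul] at hle
  rw [ENNReal.toReal_ofReal (by positivity), ENNReal.toReal_ofReal (by positivity),
    ← mul_assoc] at hle
  have h2 := le_of_mul_le_mul_right hle hμ
  have h3 : R + t / 2 = (1 + 2 * R / t) * (t / 2) := by field_simp; ring
  rw [h3, mul_pow] at h2
  exact le_of_mul_le_mul_right h2 (by positivity)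

theorem exists_finset_net {R t : ℝ} (hR : 0 ≤ R) (ht : 0 < t) :
    ∃ F : Finset E, (F.card : ℝ) ≤ (1 + 2 * R / t) ^ Module.finrank ℝ E ∧
      (∀ x ∈ F, ‖x‖ ≤ R) ∧ ∀ x : E, ‖x‖ ≤ R → ∃ y ∈ F, ‖x - y‖ ≤ t := by
  classical
  borelize E
  let Good : Finset E → Prop := fun F =>
    (∀ x ∈ F, ‖x‖ ≤ R) ∧ ∀ x ∈ F, ∀ y ∈ F, x ≠ y → t ≤ ‖x - y‖
  obtain ⟨N, hN⟩ : ∃ N : ℕ, ∀ F, Good F → F.card ≤ N := by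
    refine ⟨⌊(1 + 2 * R / t) ^ Module.finrank ℝ E⌋₊, fun F hF => Nat.le_floor ?_⟩
    exact card_le_of_separated_of_norm_le hR ht F hF.1 hF.2
  obtain ⟨F, hF, hmax⟩ : ∃ F, Good F ∧ ∀ G, Good G → G.card ≤ F.card := by
    have hbdd : BddAbove {n | ∃ F, Good F ∧ F.card = n} := by
      refine ⟨N, ?_⟩
      rintro _ ⟨F, hF, rfl⟩
      exact hN F hF
    obtain ⟨F, hF, hc⟩ := Nat.sSup_mem (s := {n | ∃ F, Good F ∧ F.card = n})
      ⟨0, ∅, by simp [Good], rfl⟩ hbdd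
    refine ⟨F, hF, fun G hG => ?_⟩
    rw [hc]
    exact le_csSup hbdd ⟨G, hG, rfl⟩
  refine ⟨F, card_le_of_separated_of_norm_le hR ht F hF.1 hF.2, hF.1, fun x hx => ?_⟩
  by_contra! hcon
  have hxF : x ∉ F := fun h => by simpa using ht.trans (hcon x h)
  have hgood : Good (insert x F) := by
    refine ⟨by simpa [hx] using hF.1, ?_⟩
    intro a ha c hc hac
    rcases Finset.mem_insert.1 ha with rfl | ha'
    · rcases Finset.mem_insert.1 hc with rfl | hc
      · exact absurd rfl hac
      · exact (hcon c hc).le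
    · rcases Finset.mem_insert.1 hc with rfl | hc
      · rw [norm_sub_rev]; exact (hcon a ha').le
      · exact hF.2 a ha' c hc hac
  have := hmax _ hgood
  rw [Finset.card_insert_of_notMem hxF] at this
  omega

/-- The ball of radius `√(1 - R⁻²)` is covered by boundedly many translates of the lens cut out
by two nearly orthogonal balls. -/
theorem measureReal_closedBall_le_mul_lens [MeasurableSpace E] [BorelSpace E] (μ : Measure E)
    [μ.IsAddHaarMeasure] {R t : ℝ}
    (hR : 1 < R) (ht : 0 < t) {x : E} (hx : ‖x‖ ≤ R) :
    μ.real (Metric.closedBall (0 : E) (√(R ^ 2 - 1) / R)) ≤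
      (2 * ⌈√(R ^ 2 - 1) / R / t⌉₊ + 1) *
        μ.real (Metric.closedBall x (1 + t) ∩ Metric.closedBall 0 (√(R ^ 2 - 1) + t)) := by
  set S := √(R ^ 2 - 1) with hS
  have hS2 : S ^ 2 = R ^ 2 - 1 := Real.sq_sqrt (by nlinarith)
  have hS0 : 0 < S := Real.sqrt_pos.2 (by nlinarith)
  set ρ := S / R with hρ
  have hρ0 : 0 < ρ := by positivity
  have hρ2 : ρ ^ 2 = 1 - 1 / R ^ 2 := by rw [hρ, div_pow, hS2]; field_simp
  set K : ℕ := ⌈ρ / t⌉₊ with hK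
  set A := Metric.closedBall x (1 + t) ∩ Metric.closedBall (0 : E) (S + t) with hA
  obtain ⟨e, hxe, he⟩ : ∃ e : E, x = ‖x‖ • e ∧ (e = 0 ∨ ‖e‖ = 1) := by
    rcases eq_or_ne x 0 with rfl | h0
    · exact ⟨0, by simp, Or.inl rfl⟩
    · refine ⟨‖x‖⁻¹ • x, ?_, Or.inr ?_⟩
      · rw [smul_smul, mul_inv_cancel₀ (norm_ne_zero_iff.2 h0), one_smul]
      · rw [norm_smul, norm_inv, norm_norm, inv_mul_cancel₀ (norm_ne_zero_iff.2 h0)]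
  set z := (1 - 1 / R ^ 2) • x with hz
  have hR2 : 0 < R ^ 2 := by positivity
  have hfrac : 0 ≤ 1 - 1 / R ^ 2 := hρ2 ▸ sq_nonneg ρ
  have hsub : Metric.closedBall (0 : E) ρ ⊆
      ⋃ i ∈ Finset.Icc (-(K : ℤ)) K, (fun y => y + (z - ((i : ℝ) * t) • e)) ⁻¹' A := by
    intro w hw
    have hw' : ‖w‖ ≤ ρ := by simpa using hw
    have hhe : |⟪w, e⟫| ≤ ρ := by
      refine (abs_real_inner_le_norm w e).trans ?_
      rcases he with rfl | he
      · simpa using hρ0.le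
      · simpa [he] using hw'
    set h := ⟪w, e⟫ with hh
    set i := ⌊h / t⌋ with hi
    have hi1 : (i : ℝ) * t ≤ h := by
      have := Int.floor_le (h / t); rwa [le_div_iff₀ ht] at this
    have hi2 : h ≤ (i : ℝ) * t + t := by
      have := (Int.lt_floor_add_one (h / t)).le; rw [div_le_iff₀ ht] at this
      linarith
    have hiK : i ∈ Finset.Icc (-(K : ℤ)) K := by
      have hKρ : ρ / t ≤ K := Nat.le_ceil _
      rw [div_le_iff₀ ht] at hKρ
      rw [abs_le] at hhe
      rw [Finset.mem_Icc]
      constructor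
      · rw [hi, Int.le_floor, le_div_iff₀ ht]
        push_cast
        linarith
      · have h1 : (i : ℝ) * t ≤ K * t := by linarith
        exact_mod_cast le_of_mul_le_mul_right h1 ht
    refine Set.mem_iUnion₂.2 ⟨i, hiK, ?_⟩
    set v := w - ((i : ℝ) * t) • e with hv
    obtain ⟨δ, hδ0, hδt, hve, hvn⟩ : ∃ δ : ℝ, 0 ≤ δ ∧ δ ≤ t ∧ ⟪v, e⟫ = δ ∧
        ‖v‖ ^ 2 ≤ ρ ^ 2 + t ^ 2 := by
      have hw2 : ‖w‖ ^ 2 ≤ ρ ^ 2 := by gcongr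
      rcases he with rfl | he
      · refine ⟨0, le_rfl, ht.le, by simp, ?_⟩
        simp only [hv, smul_zero, sub_zero]
        nlinarith [sq_nonneg t]
      · refine ⟨h - i * t, by linarith, by linarith, ?_, ?_⟩
        · rw [hv, inner_sub_left, inner_smul_left, real_inner_self_eq_norm_sq, he]
          simp [hh]
        · rw [hv, norm_sub_sq_real, norm_smul, he, inner_smul_right, ← hh]
          simp only [Real.norm_eq_abs, mul_one, sq_abs]
          nlinarith [sq_nonneg h]
    have hvx : ⟪v, x⟫ = ‖x‖ * δ := by
      conv_lhs => rw [hxe]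
      rw [inner_smul_right, hve]
    have hmem : w + (z - ((i : ℝ) * t) • e) = z + v := by rw [hv]; abel
    change w + (z - ((i : ℝ) * t) • e) ∈ A
    rw [hmem, hA, Set.mem_inter_iff, mem_closedBall_iff_norm, mem_closedBall_zero_iff]
    have hx2 : ‖x‖ ^ 2 ≤ R ^ 2 := by gcongr
    have hxδ : ‖x‖ * δ ≤ R * t := by gcongr
    have hxδ0 : 0 ≤ ‖x‖ * δ := by positivity
    constructor
    · apply (sq_le_sq₀ (norm_nonneg _) (by positivity)).1
      have hzx : z + v - x = v - (1 / R ^ 2) • x := by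
        rw [hz, sub_smul, one_smul]; abel
      rw [hzx, norm_sub_sq_real, norm_smul, inner_smul_right, hvx, mul_pow]
      rw [Real.norm_eq_abs, abs_of_pos (by positivity : (0:ℝ) < 1 / R ^ 2)]
      have h1 : (1 / R ^ 2) ^ 2 * ‖x‖ ^ 2 ≤ (1 / R ^ 2) ^ 2 * R ^ 2 := by gcongr
      have h2 : (1 / R ^ 2) ^ 2 * R ^ 2 = 1 / R ^ 2 := by field_simp
      have h3 : 0 ≤ 1 / R ^ 2 * (‖x‖ * δ) := by positivity
      nlinarith
    · apply (sq_le_sq₀ (norm_nonneg _) (by positivity)).1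
      rw [add_comm z v, norm_add_sq_real, hz, norm_smul, inner_smul_right, hvx, mul_pow,
        Real.norm_eq_abs, sq_abs]
      have h1 : (1 - 1 / R ^ 2) ^ 2 * ‖x‖ ^ 2 ≤ (1 - 1 / R ^ 2) ^ 2 * R ^ 2 := by gcongr
      have h2 : (1 - 1 / R ^ 2) ^ 2 * R ^ 2 + (1 - 1 / R ^ 2) = S ^ 2 := by
        rw [hS2]; field_simp; ring
      have h3 : (1 - 1 / R ^ 2) * (‖x‖ * δ) ≤ (1 - 1 / R ^ 2) * (R * t) := by gcongr
      have h4 : (1 - 1 / R ^ 2) * R ≤ S := by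
        apply (sq_le_sq₀ (by positivity) hS0.le).1
        rw [mul_pow]; linarith
      have h5 : (1 - 1 / R ^ 2) * R * t ≤ S * t := by gcongr
      nlinarith
  have hfin : ∀ i ∈ Finset.Icc (-(K : ℤ)) K,
      μ ((fun y => y + (z - ((i : ℝ) * t) • e)) ⁻¹' A) ≠ ⊤ := by
    intro i _
    rw [measure_preimage_add_right]
    exact ((measure_mono Set.inter_subset_right).trans_lt measure_closedBall_lt_top).ne
  calc μ.real (Metric.closedBall (0 : E) ρ)
      ≤ μ.real (⋃ i ∈ Finset.Icc (-(K : ℤ)) K, (fun y => y + (z - ((i : ℝ) * t) • e)) ⁻¹' A) :=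
        measureReal_mono hsub (((measure_biUnion_finset_le _ _).trans_lt
          (ENNReal.sum_lt_top.2 fun i hi => (hfin i hi).lt_top)).ne)
    _ ≤ ∑ i ∈ Finset.Icc (-(K : ℤ)) K, μ.real ((fun y => y + (z - ((i : ℝ) * t) • e)) ⁻¹' A) :=
        measureReal_biUnion_finset_le _ _
    _ = (2 * K + 1) * μ.real A := by
        simp only [measureReal_def, measure_preimage_add_right, Finset.sum_const, nsmul_eq_mul]
        congr 1
        rw [Int.card_Icc]
        have : ((K : ℤ) + 1 - -K).toNat = 2 * K + 1 := by omega
        rw [this]; push_cast; ring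
theorem exists_finset_cover_closedBall {R D : ℝ} (hR : 1 < R) (hD : R < D) :
    ∃ C : ℝ, 1 ≤ C ∧ ∀ (E : Type) [NormedAddCommGroup E] [InnerProductSpace ℝ E]
      [FiniteDimensional ℝ E], ∃ T : Finset E, (T.card : ℝ) ≤ C * D ^ Module.finrank ℝ E ∧
        ∀ x : E, ‖x‖ ≤ R → ∃ c ∈ T, ‖x - c‖ ≤ 1 := by
  classical
  have hS0 : 0 < √(R ^ 2 - 1) := Real.sqrt_pos.2 (by nlinarith)
  obtain ⟨t, ht, htD⟩ : ∃ t : ℝ, 0 < t ∧ R * (1 + 2 * t) * (1 + t / √(R ^ 2 - 1)) < D := by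
    have hcont : Tendsto (fun t : ℝ => R * (1 + 2 * t) * (1 + t / √(R ^ 2 - 1)))
        (nhdsWithin 0 (Set.Ioi 0)) (nhds (R * (1 + 2 * 0) * (1 + 0 / √(R ^ 2 - 1)))) := by
      apply Tendsto.mono_left _ nhdsWithin_le_nhds
      exact Continuous.tendsto (by fun_prop) 0
    simp only [mul_zero, add_zero, mul_one, zero_div] at hcont
    obtain ⟨t, h1, h2⟩ :=
      ((hcont.eventually (gt_mem_nhds hD)).and self_mem_nhdsWithin).exists
    exact ⟨t, h2, h1⟩
  set R' := R * (1 + 2 * t) with hR'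
  have hRR' : R ≤ R' := by rw [hR']; nlinarith
  have hR'1 : 1 < R' := hR.trans_le hRR'
  set S := √(R' ^ 2 - 1) with hS
  have hSS : √(R ^ 2 - 1) ≤ S := Real.sqrt_le_sqrt (by nlinarith)
  have hSpos : 0 < S := hS0.trans_le hSS
  set M : ℝ := 2 * ⌈S / R' / t⌉₊ + 1 with hM
  have hM1 : 1 ≤ M := by rw [hM]; linarith [Nat.cast_nonneg (α := ℝ) ⌈S / R' / t⌉₊]
  set D' := R' * (1 + t / S) with hD'
  have hD'D : D' < D := by
    refine lt_of_le_of_lt ?_ htD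
    rw [hD']
    gcongr
  have hD'1 : 1 < D' := by
    have : 0 < t / S := by positivity
    rw [hD']; nlinarith
  set Q := 1 + 2 * R' / t with hQ
  have hQ1 : 1 < Q := by
    have : 0 < 2 * R' / t := by positivity
    linarith
  have hlogQ : 0 < Real.log Q := Real.log_pos hQ1
  have hθ : 0 < D / D' - 1 := by
    rw [sub_pos, lt_div_iff₀ (by linarith)]; linarith
  refine ⟨Real.log Q * M / (D / D' - 1) + 1, ?_, ?_⟩
  · have : 0 ≤ Real.log Q * M / (D / D' - 1) := by positivity
    linarith
  intro E _ _ _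
  borelize E
  let μ : Measure E := Measure.addHaar
  set k := Module.finrank ℝ E with hk
  obtain ⟨F, hFcard, hFR, hFnet⟩ := exists_finset_net (E := E) (R := R') (by linarith) ht
  set p := (D' ^ k * M)⁻¹ with hp
  have hDk : 1 ≤ D' ^ k := one_le_pow₀ hD'1.le
  have hp0 : 0 < p := by positivity
  have hp1 : p ≤ 1 := inv_le_one_of_one_le₀ (by nlinarith)
  set A := Metric.closedBall (0 : E) (S + t) with hA
  have hA0 : μ A ≠ 0 := (Metric.measure_closedBall_pos _ _ (by positivity)).ne'
  have hAtop : μ A ≠ ⊤ := measure_closedBall_lt_top.ne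
  have hlens : ∀ x ∈ F, p * μ.real A ≤ μ.real (Metric.closedBall x (1 + t) ∩ A) := by
    intro x hx
    have h := measureReal_closedBall_le_mul_lens μ hR'1 ht (hFR x hx)
    rw [← hS, μ.addHaar_real_closedBall _ (by positivity)] at h
    have hball : μ.real A = (S + t) ^ k * μ.real (Metric.ball (0 : E) 1) := by
      rw [hA, μ.addHaar_real_closedBall _ (by positivity)]
    have hratio : (S + t) ^ k = D' ^ k * (S / R') ^ k := by
      rw [← mul_pow]; congr 1; rw [hD']; field_simp
    rw [hp, inv_mul_le_iff₀ (by positivity), hball, hratio]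
    calc D' ^ k * (S / R') ^ k * μ.real (Metric.ball (0 : E) 1)
        = D' ^ k * ((S / R') ^ k * μ.real (Metric.ball (0 : E) 1)) := by ring
      _ ≤ D' ^ k * (M * μ.real (Metric.closedBall x (1 + t) ∩ A)) := by gcongr
      _ = _ := by ring
  obtain ⟨T, hTcard, G, hGF, hcov, hG⟩ :=
    exists_finset_fewer_uncovered μ hA0 hAtop hp1 F hlens (⌊k * Real.log Q / p⌋₊ + 1)
  set N := ⌊k * Real.log Q / p⌋₊ + 1 with hN
  have hGempty : G = ∅ := by
    rw [← Finset.card_eq_zero]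
    have h1 : (1 - p) ^ N ≤ Real.exp (-(p * N)) := by
      rw [show -(p * (N : ℝ)) = N * (-p) by ring, Real.exp_nat_mul]
      exact pow_le_pow_left₀ (by linarith) (by linarith [Real.add_one_le_exp (-p)]) N
    have h2 : k * Real.log Q < p * N := by
      have := Nat.lt_floor_add_one (k * Real.log Q / p)
      rw [div_lt_iff₀ hp0] at this
      rw [hN]; push_cast; linarith
    have h3 : Q ^ k = Real.exp (k * Real.log Q) := by
      rw [Real.exp_nat_mul, Real.exp_log (by linarith)]
    have h4 : (G.card : ℝ) < 1 := by
      calc (G.card : ℝ) ≤ (1 - p) ^ N * F.card := hG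
        _ ≤ Real.exp (-(p * N)) * Q ^ k := by gcongr
        _ = Real.exp (-(p * N) + k * Real.log Q) := by rw [h3, Real.exp_add]
        _ < 1 := by rw [Real.exp_lt_one_iff]; linarith
    exact_mod_cast Nat.lt_one_iff.1 (by exact_mod_cast h4)
  refine ⟨T.image fun c => (1 + 2 * t)⁻¹ • c, ?_, ?_⟩
  · have h1 : (N : ℝ) ≤ k * Real.log Q / p + 1 := by
      rw [hN]; push_cast
      linarith [Nat.floor_le (show 0 ≤ k * Real.log Q / p by positivity)]
    have h2 : (k : ℝ) * (D / D' - 1) ≤ (D / D') ^ k := by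
      have := one_add_mul_le_pow (show -2 ≤ D / D' - 1 by linarith) k
      rw [add_sub_cancel] at this
      linarith
    have h3 : (k : ℝ) * D' ^ k ≤ D ^ k / (D / D' - 1) := by
      rw [le_div_iff₀ hθ]
      calc (k : ℝ) * D' ^ k * (D / D' - 1) = (k * (D / D' - 1)) * D' ^ k := by ring
        _ ≤ (D / D') ^ k * D' ^ k := by gcongr
        _ = D ^ k := by rw [← mul_pow, div_mul_cancel₀ _ (by positivity)]
    have h4 : (k : ℝ) * Real.log Q / p = Real.log Q * M * (k * D' ^ k) := by
      rw [hp]; field_simp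
    have h5 : Real.log Q * M * (k * D' ^ k) ≤ Real.log Q * M * (D ^ k / (D / D' - 1)) := by
      gcongr
    have h6 : 1 ≤ D ^ k := one_le_pow₀ (by linarith)
    have h7 : ((T.image fun c => (1 + 2 * t)⁻¹ • c).card : ℝ) ≤ N := by
      exact_mod_cast Finset.card_image_le.trans hTcard
    calc _ ≤ (N : ℝ) := h7
      _ ≤ Real.log Q * M * (D ^ k / (D / D' - 1)) + D ^ k := by linarith
      _ = _ := by ring
  · intro x hx
    have hpos : 0 < 1 + 2 * t := by positivity
    obtain ⟨y, hyF, hy⟩ := hFnet ((1 + 2 * t) • x) (by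
      rw [norm_smul, Real.norm_eq_abs, abs_of_pos hpos, hR', mul_comm]
      gcongr)
    obtain ⟨c, hcT, hc⟩ := hcov y hyF (by simp [hGempty])
    refine ⟨(1 + 2 * t)⁻¹ • c, Finset.mem_image_of_mem _ hcT, ?_⟩
    have h1 : x - (1 + 2 * t)⁻¹ • c = (1 + 2 * t)⁻¹ • ((1 + 2 * t) • x - c) := by
      rw [smul_sub, smul_smul, inv_mul_cancel₀ hpos.ne', one_smul]
    rw [h1, norm_smul, norm_inv, Real.norm_eq_abs, abs_of_pos hpos, inv_mul_le_iff₀ hpos]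
    calc ‖(1 + 2 * t) • x - c‖ ≤ ‖(1 + 2 * t) • x - y‖ + ‖y - c‖ :=
          norm_sub_le_norm_sub_add_norm_sub _ _ _
      _ ≤ (1 + 2 * t) * 1 := by linarith

theorem exists_finset_cover_coordinate_ball {R D : ℝ} (hR : 1 < R) (hD : R < D) :
    ∃ C : ℝ, 1 ≤ C ∧ ∀ A : Finset ℕ, ∃ T : Finset (ℕ → ℝ), (T.card : ℝ) ≤ C * D ^ A.card ∧
      (∀ s ∈ T, ∀ j ∉ A, s j = 0) ∧
      ∀ x : ℕ → ℝ, ∑ j ∈ A, x j ^ 2 ≤ R ^ 2 → ∃ s ∈ T, ∑ j ∈ A, (x j - s j) ^ 2 ≤ 1 := by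
  classical
  obtain ⟨C, hC, hcov⟩ := exists_finset_cover_closedBall hR hD
  refine ⟨C, hC, fun A => ?_⟩
  obtain ⟨T, hT, hTc⟩ := hcov (EuclideanSpace ℝ A)
  rw [finrank_euclideanSpace, Fintype.card_coe] at hT
  refine ⟨T.image fun c j => if h : j ∈ A then c ⟨j, h⟩ else 0, ?_, ?_, ?_⟩
  · refine le_trans ?_ hT
    exact_mod_cast Finset.card_image_le
  · intro s hs j hj
    obtain ⟨c, -, rfl⟩ := Finset.mem_image.1 hs
    simp [hj]
  · intro x hx
    obtain ⟨c, hc, h⟩ := hTc (WithLp.toLp 2 fun j : A => x j) (by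
      rw [EuclideanSpace.norm_eq, Real.sqrt_le_left (by linarith)]
      rw [← Finset.sum_coe_sort] at hx
      simpa using hx)
    refine ⟨_, Finset.mem_image_of_mem _ hc, ?_⟩
    rw [EuclideanSpace.norm_eq, Real.sqrt_le_left (by norm_num)] at h
    rw [← Finset.sum_coe_sort]
    simpa using h

end BallCovering

section EllipsoidCovering

/-- The ellipsoid with squared semi-axes `w` in `ℝ ^ m` is covered by at most `N` translates of the
ellipsoid with squared semi-axes `w'`, blown up by `√c`. The slack `q` records the energy of the
coordinates which are left untouched. -/
def EllipsoidCovered (m : ℕ) (w w' : ℕ → ℝ) (c N : ℝ) : Prop :=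
  ∃ S : Finset (ℕ → ℝ), (S.card : ℝ) ≤ N ∧ ∀ x : ℕ → ℝ, ∀ q : ℝ, 0 ≤ q →
    ∑ j ∈ Finset.range m, x j ^ 2 / w j + q ≤ 1 →
      ∃ s ∈ S, ∑ j ∈ Finset.range m, (x j - s j) ^ 2 / w' j + q ≤ c

theorem EllipsoidCovered.refl (m : ℕ) (w : ℕ → ℝ) : EllipsoidCovered m w w 1 1 :=
  ⟨{0}, by simp, fun x q _ h => ⟨0, by simp, by simpa using h⟩⟩

theorem EllipsoidCovered.trans {m : ℕ} {w w' w'' : ℕ → ℝ} {c c' N N' : ℝ} (hc : 0 < c)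
    (h : EllipsoidCovered m w w' c N) (h' : EllipsoidCovered m w' w'' c' N') :
    EllipsoidCovered m w w'' (c * c') (N * N') := by
  classical
  obtain ⟨S, hS, hcov⟩ := h
  obtain ⟨S', hS', hcov'⟩ := h'
  refine ⟨(S ×ˢ S').image fun p => p.1 + √c • p.2, ?_, ?_⟩
  · calc (((S ×ˢ S').image fun p => p.1 + √c • p.2).card : ℝ) ≤ (S ×ˢ S').card := by
          exact_mod_cast Finset.card_image_le
      _ = S.card * S'.card := by rw [Finset.card_product]; push_cast; ring
      _ ≤ N * N' := mul_le_mul hS hS' (by positivity) ((Nat.cast_nonneg _).trans hS)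
  · intro x q hq hx
    obtain ⟨s, hs, hxs⟩ := hcov x q hq hx
    have hsq : √c ^ 2 = c := Real.sq_sqrt hc.le
    have hsc : 0 < √c := Real.sqrt_pos.2 hc
    obtain ⟨s', hs', hxs'⟩ := hcov' (fun j => (x j - s j) / √c) (q / c) (by positivity) (by
      have h1 : ∑ j ∈ Finset.range m, ((x j - s j) / √c) ^ 2 / w' j + q / c =
          (∑ j ∈ Finset.range m, (x j - s j) ^ 2 / w' j + q) / c := by
        rw [add_div, Finset.sum_div]
        congr 1
        refine Finset.sum_congr rfl fun j _ => ?_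
        rw [div_pow, hsq]; ring
      rw [h1, div_le_one hc]
      exact hxs)
    refine ⟨s + √c • s', Finset.mem_image.2 ⟨(s, s'), Finset.mk_mem_product hs hs', rfl⟩, ?_⟩
    have h1 : ∑ j ∈ Finset.range m, (x j - (s + √c • s') j) ^ 2 / w'' j + q =
        c * (∑ j ∈ Finset.range m, ((x j - s j) / √c - s' j) ^ 2 / w'' j + q / c) := by
      rw [mul_add, Finset.mul_sum, mul_div_cancel₀ _ hc.ne']
      congr 1
      refine Finset.sum_congr rfl fun j _ => ?_
      have h2 : x j - (s + √c • s') j = √c * ((x j - s j) / √c - s' j) := by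
        simp only [Pi.add_apply, Pi.smul_apply, smul_eq_mul]
        field_simp
        ring
      rw [h2, mul_pow, hsq, mul_div_assoc]
    rw [h1]
    gcongr

theorem ellipsoidCovered_truncate {R D C : ℝ} (hR : 1 < R)
    (hball : ∀ A : Finset ℕ, ∃ T : Finset (ℕ → ℝ), (T.card : ℝ) ≤ C * D ^ A.card ∧
      (∀ s ∈ T, ∀ j ∉ A, s j = 0) ∧
      ∀ x : ℕ → ℝ, ∑ j ∈ A, x j ^ 2 ≤ R ^ 2 → ∃ s ∈ T, ∑ j ∈ A, (x j - s j) ^ 2 ≤ 1)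
    {lam : ℕ → ℝ} (hlam : ∀ j, 0 < lam j) (m : ℕ) {v : ℝ} (hv : 0 < v) {M : ℕ} (hM : 0 < M) :
    EllipsoidCovered m (fun j => min (lam j) (R ^ 2 * v)) (fun j => min (lam j) v) (1 + 1 / M)
      ((M + 1) * C * D ^ ((Finset.range m).filter fun j => v < lam j).card) := by
  classical
  set A := (Finset.range m).filter fun j => v < lam j with hA
  set B := (Finset.range m).filter fun j => ¬ v < lam j with hB
  obtain ⟨T, hT, hTsupp, hTcov⟩ := hball A
  have hM' : (0 : ℝ) < M := by exact_mod_cast hM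
  have hRv : v ≤ R ^ 2 * v := le_mul_of_one_le_left hv.le (one_le_pow₀ hR.le)
  refine ⟨((Finset.range (M + 1)) ×ˢ T).image
    fun p => √(((p.1 : ℝ) + 1) / M * v) • p.2, ?_, ?_⟩
  · calc _ ≤ (((Finset.range (M + 1)) ×ˢ T).card : ℝ) := by exact_mod_cast Finset.card_image_le
      _ = (M + 1) * T.card := by rw [Finset.card_product]; simp
      _ ≤ (M + 1) * (C * D ^ A.card) := by gcongr
      _ = _ := by ring
  · intro x q hq hx
    have hsplit : ∀ f : ℕ → ℝ, ∑ j ∈ Finset.range m, f j = ∑ j ∈ A, f j + ∑ j ∈ B, f j :=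
      fun f => (Finset.sum_filter_add_sum_filter_not _ _ _).symm
    have hwpos : ∀ j, 0 < min (lam j) (R ^ 2 * v) := fun j => lt_min (hlam j) (by positivity)
    rw [hsplit] at hx
    set p := ∑ j ∈ A, x j ^ 2 / min (lam j) (R ^ 2 * v) with hp
    have hp0 : 0 ≤ p := Finset.sum_nonneg fun j _ => div_nonneg (sq_nonneg _) (hwpos j).le
    have hB0 : 0 ≤ ∑ j ∈ B, x j ^ 2 / min (lam j) (R ^ 2 * v) :=
      Finset.sum_nonneg fun j _ => div_nonneg (sq_nonneg _) (hwpos j).le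
    have hp1 : p ≤ 1 := by linarith
    set i := ⌊p * M⌋₊ with hi
    have hiM : i ∈ Finset.range (M + 1) := by
      rw [Finset.mem_range, Nat.lt_succ_iff]
      apply Nat.floor_le_of_le
      nlinarith
    have hi1 : p ≤ ((i : ℝ) + 1) / M := by
      rw [le_div_iff₀ hM']; exact (Nat.lt_floor_add_one _).le
    have hi2 : ((i : ℝ) + 1) / M ≤ p + 1 / M := by
      rw [add_div]
      gcongr
      rw [div_le_iff₀ hM']
      exact Nat.floor_le (by positivity)
    set g := ((i : ℝ) + 1) / M * v with hg
    have hg0 : 0 < g := by positivity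
    have hsg : 0 < √g := Real.sqrt_pos.2 hg0
    have hsg2 : √g ^ 2 = g := Real.sq_sqrt hg0.le
    have hhead : ∑ j ∈ A, x j ^ 2 ≤ p * (R ^ 2 * v) := by
      rw [hp, Finset.sum_mul]
      refine Finset.sum_le_sum fun j _ => ?_
      rw [div_mul_eq_mul_div, le_div_iff₀ (hwpos j)]
      exact mul_le_mul_of_nonneg_left (min_le_right _ _) (sq_nonneg _)
    obtain ⟨s, hs, hxs⟩ := hTcov (fun j => x j / √g) (by
      simp only [div_pow, hsg2]
      rw [← Finset.sum_div, div_le_iff₀ hg0]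
      calc _ ≤ p * (R ^ 2 * v) := hhead
        _ ≤ ((i : ℝ) + 1) / M * (R ^ 2 * v) := by gcongr
        _ = R ^ 2 * g := by rw [hg]; ring)
    refine ⟨√g • s, Finset.mem_image.2 ⟨(i, s), Finset.mk_mem_product hiM hs, rfl⟩, ?_⟩
    rw [hsplit]
    have hAsum : ∑ j ∈ A, (x j - (√g • s) j) ^ 2 / min (lam j) v ≤ ((i : ℝ) + 1) / M := by
      have h1 : ∀ j ∈ A, (x j - (√g • s) j) ^ 2 / min (lam j) v =
          ((i : ℝ) + 1) / M * (x j / √g - s j) ^ 2 := by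
        intro j hj
        have hvj : v < lam j := (Finset.mem_filter.1 hj).2
        have h2 : x j - (√g • s) j = √g * (x j / √g - s j) := by
          simp only [Pi.smul_apply, smul_eq_mul]; field_simp
        rw [min_eq_right hvj.le, h2, mul_pow, hsg2, hg]
        field_simp
      rw [Finset.sum_congr rfl h1, ← Finset.mul_sum]
      exact mul_le_of_le_one_right (by positivity) hxs
    have hBsum : ∑ j ∈ B, (x j - (√g • s) j) ^ 2 / min (lam j) v =
        ∑ j ∈ B, x j ^ 2 / min (lam j) (R ^ 2 * v) := by
      refine Finset.sum_congr rfl fun j hj => ?_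
      have hvj : lam j ≤ v := not_lt.1 (Finset.mem_filter.1 hj).2
      have hjA : j ∉ A := fun h => (Finset.mem_filter.1 hj).2 (Finset.mem_filter.1 h).2
      rw [min_eq_left hvj, min_eq_left (hvj.trans hRv), Pi.smul_apply, hTsupp s hs j hjA]
      simp
    linarith

theorem ellipsoidCovered_iterate {R D C : ℝ} (hR : 1 < R)
    (hball : ∀ A : Finset ℕ, ∃ T : Finset (ℕ → ℝ), (T.card : ℝ) ≤ C * D ^ A.card ∧
      (∀ s ∈ T, ∀ j ∉ A, s j = 0) ∧
      ∀ x : ℕ → ℝ, ∑ j ∈ A, x j ^ 2 ≤ R ^ 2 → ∃ s ∈ T, ∑ j ∈ A, (x j - s j) ^ 2 ≤ 1)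
    {lam : ℕ → ℝ} (hlam : ∀ j, 0 < lam j) (m : ℕ) {e : ℝ} (he : 0 < e) {M : ℕ} (hM : 0 < M)
    (L : ℕ) :
    EllipsoidCovered m (fun j => min (lam j) ((R ^ 2) ^ L * e)) (fun j => min (lam j) e)
      ((1 + 1 / M) ^ L) (((M + 1) * C) ^ L * D ^ ∑ i ∈ Finset.range L,
        ((Finset.range m).filter fun j => (R ^ 2) ^ i * e < lam j).card) := by
  induction L with
  | zero => simpa using EllipsoidCovered.refl m fun j => min (lam j) e
  | succ L ih =>
    have h := (ellipsoidCovered_truncate hR hball hlam m (v := (R ^ 2) ^ L * e)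
      (by positivity) hM).trans (by positivity) ih
    rw [Finset.sum_range_succ, pow_add]
    convert h using 1
    · ext j; congr 1; ring
    · ring
    · ring

theorem sum_card_levels_le {R e : ℝ} (hR : 1 < R) (he : 0 < e) {lam : ℕ → ℝ}
    (hlam : ∀ j, 0 < lam j) (m L : ℕ) :
    ((∑ i ∈ Finset.range L, ((Finset.range m).filter fun j => (R ^ 2) ^ i * e < lam j).card : ℕ) : ℝ)
      ≤ ∑ j ∈ Finset.range m, (max 0 (Real.log (lam j / e)) / (2 * Real.log R) + 1) := by
  have hlogR : 0 < 2 * Real.log R := by have := Real.log_pos hR; positivity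
  have hswap : ∑ i ∈ Finset.range L, ((Finset.range m).filter fun j => (R ^ 2) ^ i * e < lam j).card
      = ∑ j ∈ Finset.range m, ((Finset.range L).filter fun i => (R ^ 2) ^ i * e < lam j).card := by
    simp only [Finset.card_filter]
    exact Finset.sum_comm
  rw [hswap, Nat.cast_sum]
  refine Finset.sum_le_sum fun j _ => ?_
  set y := max 0 (Real.log (lam j / e)) / (2 * Real.log R) with hy
  have hsub : ((Finset.range L).filter fun i => (R ^ 2) ^ i * e < lam j) ⊆
      Finset.range (⌊y⌋₊ + 1) := by
    intro i hi
    rw [Finset.mem_filter] at hi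
    rw [Finset.mem_range, Nat.lt_succ_iff]
    apply Nat.le_floor
    rw [hy, le_div_iff₀ hlogR]
    refine le_max_of_le_right ?_
    rw [Real.le_log_iff_exp_le (div_pos (hlam j) he), le_div_iff₀ he]
    refine le_trans (le_of_eq ?_) hi.2.le
    congr 1
    rw [Real.exp_nat_mul, two_mul, Real.exp_add, Real.exp_log (by linarith), sq]
  calc (_ : ℝ) ≤ ((Finset.range (⌊y⌋₊ + 1)).card : ℝ) := by
        exact_mod_cast Finset.card_le_card hsub
    _ = ⌊y⌋₊ + 1 := by simp
    _ ≤ y + 1 := by gcongr; exact Nat.floor_le (by positivity)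

end EllipsoidCovering

section EntropyNumbers

variable {H : Type*} [NormedAddCommGroup H]

theorem sInf_norm_sub_nonneg (α : Finset H) (x : H) :
    0 ≤ sInf ((fun a => ‖x - a‖) '' (α : Set H)) := by
  refine Real.sInf_nonneg ?_
  rintro _ ⟨a, -, rfl⟩
  exact norm_nonneg _

theorem sInf_norm_sub_le {α : Finset H} {a : H} (ha : a ∈ α) (x : H) :
    sInf ((fun a => ‖x - a‖) '' (α : Set H)) ≤ ‖x - a‖ := by
  refine csInf_le ⟨0, ?_⟩ ⟨a, ha, rfl⟩
  rintro _ ⟨c, -, rfl⟩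
  exact norm_nonneg _

theorem sSup_sInf_norm_sub_nonneg (α : Finset H) (K : Set H) :
    0 ≤ sSup ((fun x => sInf ((fun a => ‖x - a‖) '' (α : Set H))) '' K) := by
  refine Real.sSup_nonneg ?_
  rintro _ ⟨x, -, rfl⟩
  exact sInf_norm_sub_nonneg α x

theorem entropyNum_le {K : Set H} (hK : K.Nonempty) {n : ℕ} {r : ℝ} {α : Finset H}
    (hα : α.card ≤ n) (h : ∀ x ∈ K, ∃ a ∈ α, ‖x - a‖ ≤ r) : entropyNum K n ≤ r := by
  obtain ⟨x₀, hx₀⟩ := hK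
  obtain ⟨a₀, ha₀, -⟩ := h x₀ hx₀
  refine csInf_le_of_le ⟨0, ?_⟩ ⟨α, ⟨a₀, ha₀⟩, hα, rfl⟩ ?_
  · rintro _ ⟨β, -, -, rfl⟩
    exact sSup_sInf_norm_sub_nonneg β K
  · refine csSup_le (Set.Nonempty.image _ ⟨x₀, hx₀⟩) ?_
    rintro _ ⟨x, hx, rfl⟩
    obtain ⟨a, ha, hxa⟩ := h x hx
    exact (sInf_norm_sub_le ha x).trans hxa

theorem le_entropyNum {K : Set H} (hK : Bornology.IsBounded K) {n : ℕ} (hn : 1 ≤ n) {r : ℝ}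
    (h : ∀ α : Finset H, α.card ≤ n → ∀ r₀ : ℝ, 0 ≤ r₀ → (∀ x ∈ K, ∃ a ∈ α, ‖x - a‖ ≤ r₀) →
      r ≤ r₀) : r ≤ entropyNum K n := by
  refine le_csInf ⟨_, {0}, by simp, by simpa using hn, rfl⟩ ?_
  rintro _ ⟨α, hα, hcard, rfl⟩
  refine h α hcard _ (sSup_sInf_norm_sub_nonneg α K) ?_
  · intro x hx
    obtain ⟨B, hB⟩ := hK.exists_norm_le
    obtain ⟨a₀, ha₀⟩ := hα
    have hbdd : BddAbove ((fun x => sInf ((fun a => ‖x - a‖) '' (α : Set H))) '' K) := by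
      refine ⟨B + ‖a₀‖, ?_⟩
      rintro _ ⟨y, hy, rfl⟩
      exact (sInf_norm_sub_le ha₀ y).trans ((norm_sub_le _ _).trans (by linarith [hB y hy]))
    have hne : ((fun a => ‖x - a‖) '' (α : Set H)).Nonempty := ⟨_, a₀, ha₀, rfl⟩
    obtain ⟨a, ha, hxa⟩ := hne.csInf_mem (α.finite_toSet.image _)
    refine ⟨a, ha, ?_⟩
    change ‖x - a‖ = _ at hxa
    rw [hxa]
    exact le_csSup hbdd ⟨x, hx, rfl⟩

variable [InnerProductSpace ℝ H]

/-- The ellipsoid with squared semi-axes `lam` along the orthonormal system `u`. -/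
def ellipsoid (u : ℕ → H) (lam : ℕ → ℝ) : Set H :=
  {x ∈ closure (Submodule.span ℝ (Set.range u) : Set H) |
    Summable (fun j => ⟪x, u j⟫ ^ 2 / lam j) ∧ ∑' j, ⟪x, u j⟫ ^ 2 / lam j ≤ 1}

theorem hasSum_inner_sq_of_mem_closure_span [CompleteSpace H] {u : ℕ → H}
    (hu : Orthonormal ℝ u) {x : H}
    (hx : x ∈ closure (Submodule.span ℝ (Set.range u) : Set H)) :
    HasSum (fun j => ⟪x, u j⟫ ^ 2) (‖x‖ ^ 2) := by
  set K := (Submodule.span ℝ (Set.range u)).topologicalClosure with hK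
  have huK : ∀ j, u j ∈ K := fun j =>
    Submodule.le_topologicalClosure _ (Submodule.subset_span ⟨j, rfl⟩)
  let u' : ℕ → K := fun j => ⟨u j, huK j⟩
  have hu' : Orthonormal ℝ u' := by
    refine ⟨fun j => by simpa using hu.1 j, fun i j hij => by simpa [u'] using hu.2 hij⟩
  have : CompleteSpace K :=
    (Submodule.isClosed_topologicalClosure _).completeSpace_coe
  have hdense : ⊤ ≤ (Submodule.span ℝ (Set.range u')).topologicalClosure := by
    rintro ⟨y, hy⟩ -
    have hy' : y ∈ closure (Submodule.span ℝ (Set.range u) : Set H) := hy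
    change (⟨y, hy⟩ : K) ∈ closure (Submodule.span ℝ (Set.range u') : Set K)
    rw [closure_subtype]
    have himg : ((↑) : K → H) '' (Submodule.span ℝ (Set.range u') : Set K) =
        (Submodule.span ℝ (Set.range u) : Set H) := by
      have h1 : (Submodule.span ℝ (Set.range u')).map K.subtype =
          Submodule.span ℝ (Set.range u) := by
        rw [Submodule.map_span, ← Set.range_comp]
        rfl
      rw [← h1]
      rfl
    rw [himg]
    exact hy'
  let b := HilbertBasis.mk hu' hdense
  have hb := b.hasSum_inner_mul_inner ⟨x, hx⟩ ⟨x, hx⟩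
  have hcoe : ∀ j, b j = u' j := fun j => by rw [HilbertBasis.coe_mk]
  simp only [hcoe, real_inner_self_eq_norm_sq] at hb
  have hfun : (fun j => ⟪x, u j⟫ ^ 2) = fun j => ⟪x, u j⟫ * ⟪u j, x⟫ := by
    funext j
    rw [real_inner_comm, sq]
  rw [hfun]
  exact hb

theorem norm_sq_le_of_mem_ellipsoid [CompleteSpace H] {u : ℕ → H} (hu : Orthonormal ℝ u)
    {lam : ℕ → ℝ} (hlam : ∀ j, 0 < lam j) (hanti : Antitone lam) {x : H}
    (hx : x ∈ ellipsoid u lam) : ‖x‖ ^ 2 ≤ lam 0 := by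
  obtain ⟨hxc, hsum, hle⟩ := hx
  have h1 := hasSum_inner_sq_of_mem_closure_span hu hxc
  have h2 := hasSum_le (fun j => ?_) h1 (hsum.hasSum.mul_left (lam 0))
  · nlinarith [hlam 0]
  · rw [mul_div_assoc', le_div_iff₀ (hlam j), mul_comm]
    exact mul_le_mul_of_nonneg_right (hanti (Nat.zero_le j)) (sq_nonneg _)

theorem zero_mem_ellipsoid (u : ℕ → H) (lam : ℕ → ℝ) : (0 : H) ∈ ellipsoid u lam :=
  ⟨subset_closure (Submodule.zero_mem _), by simp [summable_zero], by simp⟩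

theorem inner_sum_range_smul {u : ℕ → H} (hu : Orthonormal ℝ u) (m : ℕ) (s : ℕ → ℝ) (j : ℕ) :
    ⟪∑ i ∈ Finset.range m, s i • u i, u j⟫ = if j < m then s j else 0 := by
  classical
  rw [sum_inner]
  simp only [inner_smul_left, orthonormal_iff_ite.1 hu]
  simp

theorem sum_range_smul_mem_closure_span (u : ℕ → H) (m : ℕ) (s : ℕ → ℝ) :
    ∑ i ∈ Finset.range m, s i • u i ∈ closure (Submodule.span ℝ (Set.range u) : Set H) :=
  subset_closure (Submodule.sum_mem _ fun i _ =>
    Submodule.smul_mem _ _ (Submodule.subset_span ⟨i, rfl⟩))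

theorem entropyNum_ellipsoid_le [CompleteSpace H] {u : ℕ → H} (hu : Orthonormal ℝ u)
    {lam : ℕ → ℝ} (hlam : ∀ j, 0 < lam j) {m n : ℕ} {e c N : ℝ} (he : 0 < e)
    (htail : ∀ j, m ≤ j → lam j ≤ e)
    (hcov : EllipsoidCovered m lam (fun j => min (lam j) e) c N) (hN : N ≤ n) :
    entropyNum (ellipsoid u lam) n ≤ √(c * e) := by
  classical
  obtain ⟨S, hS, hcov⟩ := hcov
  refine entropyNum_le ⟨0, zero_mem_ellipsoid u lam⟩
    (α := S.image fun s => ∑ i ∈ Finset.range m, s i • u i) ?_ ?_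
  · exact Finset.card_image_le.trans (by exact_mod_cast hS.trans hN)
  · rintro x ⟨hxc, hsum, hle⟩
    rw [← hsum.sum_add_tsum_nat_add m] at hle
    have hsum' : Summable fun j => ⟪x, u (j + m)⟫ ^ 2 / lam (j + m) :=
      (summable_nat_add_iff m).2 hsum
    obtain ⟨s, hs, hxs⟩ := hcov (fun j => ⟪x, u j⟫) _
      (tsum_nonneg fun j => div_nonneg (sq_nonneg ⟪x, u (j + m)⟫) (hlam (j + m)).le) hle
    refine ⟨_, Finset.mem_image_of_mem _ hs, Real.le_sqrt_of_sq_le ?_⟩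
    set a := ∑ i ∈ Finset.range m, s i • u i with ha
    have hmem : x - a ∈ closure (Submodule.span ℝ (Set.range u) : Set H) :=
      Submodule.sub_mem (Submodule.span ℝ (Set.range u)).topologicalClosure hxc
        (sum_range_smul_mem_closure_span u m s)
    have hpar := hasSum_inner_sq_of_mem_closure_span hu hmem
    rw [← hpar.tsum_eq, ← hpar.summable.sum_add_tsum_nat_add m]
    have hhead : ∑ j ∈ Finset.range m, ⟪x - a, u j⟫ ^ 2 ≤
        e * ∑ j ∈ Finset.range m, (⟪x, u j⟫ - s j) ^ 2 / min (lam j) e := by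
      rw [Finset.mul_sum]
      refine Finset.sum_le_sum fun j hj => ?_
      rw [inner_sub_left, ha, inner_sum_range_smul hu, if_pos (Finset.mem_range.1 hj),
        mul_div_assoc', le_div_iff₀ (lt_min (hlam j) he), mul_comm]
      exact mul_le_mul_of_nonneg_right (min_le_right _ _) (sq_nonneg _)
    have htl : ∑' j, ⟪x - a, u (j + m)⟫ ^ 2 ≤ e * ∑' j, ⟪x, u (j + m)⟫ ^ 2 / lam (j + m) := by
      rw [← tsum_mul_left]
      refine Summable.tsum_le_tsum (fun j => ?_) ((summable_nat_add_iff m).2 hpar.summable)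
        (hsum'.mul_left e)
      rw [inner_sub_left, ha, inner_sum_range_smul hu, if_neg (by omega), sub_zero,
        mul_div_assoc', le_div_iff₀ (hlam _), mul_comm]
      exact mul_le_mul_of_nonneg_right (htail _ (by omega)) (sq_nonneg _)
    nlinarith

theorem prod_le_card_mul_pow_of_ellipsoid_cover {m : ℕ} {a : Fin m → ℝ} (ha : ∀ i, 0 < a i)
    (T : Finset (EuclideanSpace ℝ (Fin m))) {r : ℝ} (hr : 0 ≤ r)
    (hcov : ∀ v : EuclideanSpace ℝ (Fin m), ∑ i, v i ^ 2 / a i ^ 2 ≤ 1 → ∃ c ∈ T, ‖v - c‖ ≤ r) :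
    ∏ i, a i ≤ T.card * r ^ m := by
  let μ : Measure (EuclideanSpace ℝ (Fin m)) := volume
  let f : EuclideanSpace ℝ (Fin m) →ₗ[ℝ] EuclideanSpace ℝ (Fin m) :=
    Matrix.toLpLin 2 2 (Matrix.diagonal a)
  have hf : ∀ v i, f v i = a i * v i := by
    intro v i
    simp [f, Matrix.toLpLin_apply, Matrix.mulVec_diagonal]
  have hdet : LinearMap.det f = ∏ i, a i := by
    rw [← Matrix.det_diagonal]
    simp [f]
  have hsub : f '' Metric.closedBall 0 1 ⊆ ⋃ c ∈ T, Metric.closedBall c r := by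
    rintro _ ⟨v, hv, rfl⟩
    rw [mem_closedBall_zero_iff, EuclideanSpace.norm_eq, Real.sqrt_le_left zero_le_one] at hv
    obtain ⟨c, hc, h⟩ := hcov (f v) (by
      refine le_trans (le_of_eq (Finset.sum_congr rfl fun i _ => ?_)) (hv.trans (by norm_num))
      rw [hf, mul_pow, mul_div_cancel_left₀ _ (pow_ne_zero 2 (ha i).ne'), Real.norm_eq_abs,
        sq_abs])
    exact Set.mem_iUnion₂.2 ⟨c, hc, mem_closedBall_iff_norm.2 h⟩
  have hprod : 0 < ∏ i, a i := Finset.prod_pos fun i _ => ha i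
  have hfin : μ (⋃ c ∈ T, Metric.closedBall c r) ≠ ⊤ :=
    ((measure_biUnion_finset_le _ _).trans_lt
      (ENNReal.sum_lt_top.2 fun c _ => measure_closedBall_lt_top)).ne
  have hle := (measureReal_mono (μ := μ) hsub hfin).trans (measureReal_biUnion_finset_le _ _)
  simp only [μ.addHaar_real_closedBall _ hr, Finset.sum_const, nsmul_eq_mul,
    finrank_euclideanSpace_fin] at hle
  rw [measureReal_def, Measure.addHaar_image_linearMap, hdet, abs_of_pos hprod,
    ENNReal.toReal_mul, ENNReal.toReal_ofReal hprod.le, ← measureReal_def,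
    μ.addHaar_real_closedBall _ zero_le_one, one_pow, one_mul, ← mul_assoc] at hle
  refine le_of_mul_le_mul_right hle ?_
  exact ENNReal.toReal_pos (Metric.measure_ball_pos _ _ zero_lt_one).ne' measure_ball_lt_top.ne

theorem le_entropyNum_ellipsoid [CompleteSpace H] {u : ℕ → H} (hu : Orthonormal ℝ u)
    {lam : ℕ → ℝ} (hlam : ∀ j, 0 < lam j) (hanti : Antitone lam) {m n : ℕ} (hm : 1 ≤ m)
    (hn : 1 ≤ n) {r : ℝ} (h : n * r ^ m ≤ ∏ j ∈ Finset.range m, √(lam j)) :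
    r ≤ entropyNum (ellipsoid u lam) n := by
  classical
  refine le_entropyNum ?_ hn ?_
  · refine isBounded_iff_forall_norm_le.2 ⟨√(lam 0), fun x hx => ?_⟩
    exact Real.le_sqrt_of_sq_le (norm_sq_le_of_mem_ellipsoid hu hlam hanti hx)
  · intro α hα r₀ hr₀ hcov
    have hvol := prod_le_card_mul_pow_of_ellipsoid_cover (m := m) (a := fun i => √(lam i))
      (fun i => Real.sqrt_pos.2 (hlam i))
      (α.image fun a => WithLp.toLp 2 fun i : Fin m => ⟪a, u i⟫) hr₀ (by
        intro v hv
        let s : ℕ → ℝ := fun j => if hj : j < m then v ⟨j, hj⟩ else 0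
        set x := ∑ i ∈ Finset.range m, s i • u i with hx
        have hxj : ∀ j, ⟪x, u j⟫ = s j := by
          intro j
          rw [hx, inner_sum_range_smul hu]
          simp only [s]
          split_ifs <;> rfl
        have hs0 : ∀ j ∉ Finset.range m, s j ^ 2 / lam j = 0 := by
          intro j hj
          simp [s, Finset.mem_range.not.1 hj]
        have hxU : x ∈ ellipsoid u lam := by
          refine ⟨sum_range_smul_mem_closure_span u m s, ?_, ?_⟩
          · simp only [hxj]
            exact summable_of_ne_finset_zero hs0
          · simp only [hxj]
            rw [tsum_eq_sum hs0, Finset.sum_range]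
            refine le_trans (le_of_eq (Finset.sum_congr rfl fun i _ => ?_)) hv
            rw [Real.sq_sqrt (hlam i).le]
            simp [s]
        obtain ⟨a, haα, hxa⟩ := hcov x hxU
        refine ⟨_, Finset.mem_image_of_mem _ haα, le_trans ?_ hxa⟩
        rw [EuclideanSpace.norm_eq]
        refine (Real.sqrt_le_left (norm_nonneg _)).2 ?_
        refine le_trans (le_of_eq ?_)
          (hu.sum_inner_products_le (x - a) (s := Finset.range m))
        rw [Finset.sum_range]
        refine Finset.sum_congr rfl fun i _ => ?_
        rw [real_inner_comm, inner_sub_left, hxj]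
        simp [s])
    rw [← Finset.prod_range fun j => √(lam j)] at hvol
    have hcard : (((α.image fun a => WithLp.toLp 2 fun i : Fin m => ⟪a, u i⟫).card : ℕ) : ℝ) ≤ n := by
      exact_mod_cast Finset.card_image_le.trans hα
    have hn' : (0 : ℝ) < n := by exact_mod_cast hn
    have h1 : (n : ℝ) * r ^ m ≤ n * r₀ ^ m := (h.trans hvol).trans (by gcongr)
    exact le_of_pow_le_pow_left₀ (by omega) hr₀ (le_of_mul_le_mul_left h1 hn')

end EntropyNumbers

section RegularVariation

variable {φ : ℝ → ℝ} {s b : ℝ}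

/-- A two-sided Potter bound for monotone regularly varying functions. -/
theorem exists_abs_log_sub_log_le (hb : 0 < b) (hφ_pos : ∀ x, s < x → 0 < φ x)
    (hφ_dec : ∀ x y, s < x → x ≤ y → φ y ≤ φ x)
    (hφ_rv : ∀ c : ℝ, 0 < c → Tendsto (fun x : ℝ => φ (c * x) / φ x) atTop (nhds (c ^ (-b))))
    {δ : ℝ} (hδ : 0 < δ) :
    ∃ X : ℝ, s < X ∧ 1 ≤ X ∧ ∀ x y, X ≤ x → x ≤ y →
      |Real.log (φ x) - Real.log (φ y) - b * Real.log (y / x)| ≤ δ * (1 + Real.log (y / x)) := by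
  set κ := min δ b with hκ
  have hκ0 : 0 < κ := lt_min hδ hb
  set h := δ / (2 * b) with hh
  have hh0 : 0 < h := by positivity
  have hlim : Tendsto (fun x : ℝ => Real.log (φ (Real.exp h * x) / φ x)) atTop
      (nhds (-(b * h))) := by
    have h1 := (hφ_rv (Real.exp h) (Real.exp_pos h)).log
      (Real.rpow_pos_of_pos (Real.exp_pos h) _).ne'
    rw [Real.log_rpow (Real.exp_pos h), Real.log_exp] at h1
    convert h1 using 2
    ring
  obtain ⟨X₀, hX₀⟩ := eventually_atTop.1 (Metric.tendsto_nhds.1 hlim (κ * h) (by positivity))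
  set X := max X₀ (max (s + 1) 1) with hX
  have hXs : s < X := by
    have : s + 1 ≤ X := (le_max_left _ _).trans (le_max_right _ _)
    linarith
  have hX1 : 1 ≤ X := (le_max_right _ _).trans (le_max_right _ _)
  have hstep : ∀ x, X ≤ x → |Real.log (φ x) - Real.log (φ (Real.exp h * x)) - b * h| ≤ κ * h := by
    intro x hx
    have h1 := hX₀ x ((le_max_left _ _).trans hx)
    have hexp : 1 ≤ Real.exp h := Real.one_le_exp hh0.le
    have hx0 : 0 < x := by linarith
    have hxx : x ≤ Real.exp h * x := by nlinarith
    rw [Real.dist_eq, Real.log_div (hφ_pos _ (by linarith)).ne' (hφ_pos _ (by linarith)).ne'] at h1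
    rw [abs_sub_comm] at h1
    refine le_trans (le_of_eq ?_) h1.le
    congr 1
    ring
  have hiter : ∀ (n : ℕ) (x : ℝ), X ≤ x →
      |Real.log (φ x) - Real.log (φ (Real.exp (n * h) * x)) - n * (b * h)| ≤ n * (κ * h) := by
    intro n
    induction n with
    | zero => intro x _; simp
    | succ n ih =>
      intro x hx
      have hexp : 1 ≤ Real.exp (n * h) := Real.one_le_exp (by positivity)
      have hx0 : 0 < x := by linarith
      have h1 := ih x hx
      have h2 := hstep (Real.exp (n * h) * x) (by nlinarith)
      rw [← mul_assoc, ← Real.exp_add] at h2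
      have h3 : Real.exp (((n + 1 : ℕ) : ℝ) * h) = Real.exp (h + n * h) := by
        congr 1; push_cast; ring
      rw [h3]
      push_cast
      rw [abs_le] at h1 h2 ⊢
      constructor <;> linarith [h1.1, h1.2, h2.1, h2.2]
  refine ⟨X, hXs, hX1, fun x y hx hxy => ?_⟩
  have hx0 : 0 < x := by linarith
  have hy0 : 0 < y := by linarith
  set z := Real.log (y / x) with hz
  have hz0 : 0 ≤ z := Real.log_nonneg ((one_le_div hx0).2 hxy)
  have hyz : y = Real.exp z * x := by
    rw [hz, Real.exp_log (by positivity)]; field_simp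
  set n := ⌊z / h⌋₊ with hn
  have hn1 : n * h ≤ z := by
    have := Nat.floor_le (show 0 ≤ z / h by positivity)
    rwa [le_div_iff₀ hh0] at this
  have hn2 : z ≤ (n + 1) * h := by
    have := (Nat.lt_floor_add_one (z / h)).le
    rwa [div_le_iff₀ hh0] at this
  have hlo : Real.log (φ y) ≤ Real.log (φ (Real.exp (n * h) * x)) := by
    have hexp : 1 ≤ Real.exp (n * h) := Real.one_le_exp (by positivity)
    apply Real.log_le_log (hφ_pos _ (by linarith))
    apply hφ_dec _ _ (by nlinarith)
    rw [hyz]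
    gcongr
  have hup : Real.log (φ (Real.exp ((n + 1 : ℕ) * h) * x)) ≤ Real.log (φ y) := by
    have hle : y ≤ Real.exp ((n + 1 : ℕ) * h) * x := by
      rw [hyz]; push_cast; gcongr
    apply Real.log_le_log (hφ_pos _ (by linarith))
    exact hφ_dec _ _ (by linarith) hle
  have h1 := hiter n x hx
  have h2 := hiter (n + 1) x hx
  push_cast at h2 hup
  have hκδ : κ ≤ δ := min_le_left _ _
  have hκb : κ ≤ b := min_le_right _ _
  have hbh : b * h = δ / 2 := by rw [hh]; field_simp
  have hκh : κ * h ≤ δ / 2 := by rw [← hbh]; gcongr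
  have hκz : κ * z ≤ δ * z := by gcongr
  have hκn : κ * (n * h) ≤ κ * z := by gcongr
  rw [abs_le] at h1 h2 ⊢
  constructor
  · have : (b - κ) * (z - h) ≤ (b - κ) * (n * h) := by
      apply mul_le_mul_of_nonneg_left _ (by linarith)
      linarith
    nlinarith
  · have : b * (n * h) ≤ b * z := by gcongr
    nlinarith

theorem exists_abs_log_eigenvalue_sub_le (hb : 0 < b) (hφ_pos : ∀ x, s < x → 0 < φ x)
    (hφ_dec : ∀ x y, s < x → x ≤ y → φ y ≤ φ x)
    (hφ_rv : ∀ c : ℝ, 0 < c → Tendsto (fun x : ℝ => φ (c * x) / φ x) atTop (nhds (c ^ (-b))))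
    {lam : ℕ → ℝ} (hlam : ∀ j, 0 < lam j)
    (hasymp : Tendsto (fun j : ℕ => lam j / φ j) atTop (nhds 1)) {δ : ℝ} (hδ : 0 < δ) :
    ∃ J : ℕ, 1 ≤ J ∧ s < J ∧ ∀ (j : ℕ) (y : ℝ), J ≤ j → (j : ℝ) ≤ y →
      |Real.log (lam j) - Real.log (φ y) - b * Real.log (y / j)| ≤
        δ * (1 + Real.log (y / j)) := by
  obtain ⟨X, hXs, hX1, hX⟩ := exists_abs_log_sub_log_le hb hφ_pos hφ_dec hφ_rv (half_pos hδ)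
  have hlog : Tendsto (fun j : ℕ => Real.log (lam j / φ j)) atTop (nhds 0) := by
    simpa using hasymp.log one_ne_zero
  obtain ⟨J₀, hJ₀⟩ := eventually_atTop.1 (Metric.tendsto_nhds.1 hlog (δ / 2) (by positivity))
  set J := max J₀ ⌈X⌉₊ with hJ
  have hJX : X ≤ J := (Nat.le_ceil X).trans (by exact_mod_cast le_max_right _ _)
  refine ⟨J, by exact_mod_cast hX1.trans hJX, by linarith, fun j y hj hjy => ?_⟩
  have hJj : (J : ℝ) ≤ j := by exact_mod_cast hj
  have hj0 : (0 : ℝ) < j := by linarith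
  have h1 := hJ₀ j ((le_max_left _ _).trans hj)
  rw [Real.dist_eq, sub_zero,
    Real.log_div (hlam j).ne' (hφ_pos _ (by linarith)).ne'] at h1
  have h2 := hX j y (by linarith) hjy
  have hz : 0 ≤ Real.log (y / j) := Real.log_nonneg ((one_le_div hj0).2 hjy)
  rw [abs_lt] at h1
  rw [abs_le] at h2 ⊢
  constructor <;> nlinarith

theorem sum_range_log_div_succ (k : ℕ) :
    ∑ j ∈ Finset.range (k + 1), Real.log (((k + 1 : ℕ) : ℝ) / j) =
      k * Real.log (k + 1) - Real.log (k.factorial) := by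
  have hfac : ∀ k : ℕ, Real.log (k.factorial) = ∑ j ∈ Finset.range k, Real.log ((j : ℝ) + 1) := by
    intro k
    induction k with
    | zero => simp
    | succ k ih =>
      rw [Finset.sum_range_succ, ← ih, Nat.factorial_succ, Nat.cast_mul,
        Real.log_mul (by positivity) (by positivity)]
      push_cast
      ring
  rw [Finset.sum_range_succ', hfac]
  simp only [Nat.cast_zero, div_zero, Real.log_zero, add_zero]
  have : ∀ j ∈ Finset.range k, Real.log (((k + 1 : ℕ) : ℝ) / ((j + 1 : ℕ) : ℝ)) =
      Real.log (k + 1) - Real.log ((j : ℝ) + 1) := by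
    intro j _
    push_cast
    rw [Real.log_div (by positivity) (by positivity)]
  rw [Finset.sum_congr rfl this, Finset.sum_sub_distrib]
  simp

theorem sum_range_log_div_le (m : ℕ) : ∑ j ∈ Finset.range m, Real.log ((m : ℝ) / j) ≤ m := by
  rcases m with _ | k
  · simp
  rw [sum_range_log_div_succ]
  have h := Real.pow_div_factorial_le_exp (x := (k : ℝ) + 1) (by positivity) k
  have h1 := Real.log_le_log (by positivity) h
  rw [Real.log_exp, Real.log_div (by positivity) (by positivity), Real.log_pow] at h1
  push_cast
  exact h1

theorem le_sum_range_log_div {m : ℕ} (hm : 1 ≤ m) :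
    (m : ℝ) - 1 - Real.log m ≤ ∑ j ∈ Finset.range m, Real.log ((m : ℝ) / j) := by
  obtain ⟨k, rfl⟩ := Nat.exists_eq_add_of_le' hm
  rw [sum_range_log_div_succ]
  push_cast
  rw [add_sub_cancel_right]
  clear hm
  induction k with
  | zero => simp
  | succ k ih =>
    have h1 : Real.log ((k + 1).factorial : ℝ) = Real.log (k + 1) + Real.log (k.factorial) := by
      rw [Nat.factorial_succ, Nat.cast_mul, Real.log_mul (by positivity) (by positivity)]
      push_cast
      rfl
    have h2 := Real.one_sub_inv_le_log_of_pos (show (0 : ℝ) < (k + 2) / (k + 1) by positivity)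
    rw [Real.log_div (by positivity) (by positivity)] at h2
    have h3 : 1 - (((k : ℝ) + 2) / (k + 1))⁻¹ = 1 / (k + 2) := by field_simp; ring
    rw [h3, div_le_iff₀ (by positivity)] at h2
    rw [h1]
    push_cast
    rw [show (k : ℝ) + 1 + 1 = k + 2 by ring]
    nlinarith

theorem eventually_log_polynomial_le (c₀ c₁ c₂ : ℝ) {g : ℝ} (hg : 0 < g) :
    ∀ᶠ T : ℝ in atTop, c₀ + c₁ * Real.log T + c₂ * Real.log T ^ 2 ≤ g * T := by
  have h0 : (fun _ : ℝ => c₀) =o[atTop] (id : ℝ → ℝ) := by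
    simpa using Asymptotics.isLittleO_const_id_atTop c₀
  have h1 : (fun T : ℝ => c₁ * Real.log T) =o[atTop] (id : ℝ → ℝ) :=
    Real.isLittleO_log_id_atTop.const_mul_left c₁
  have h2 : (fun T : ℝ => c₂ * Real.log T ^ 2) =o[atTop] (id : ℝ → ℝ) :=
    (Real.isLittleO_pow_log_id_atTop (n := 2)).const_mul_left c₂
  filter_upwards [((h0.add h1).add h2).bound hg, eventually_ge_atTop 0] with T hT hT0
  rw [Real.norm_eq_abs, Real.norm_eq_abs, id, abs_of_nonneg hT0] at hT
  exact (le_abs_self _).trans hT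

end RegularVariation

section Asymptotics

variable {φ : ℝ → ℝ} {s b : ℝ}

/-- The covering numbers produced by the geometric refinement, with parameters `L` and `M`
adapted to the ratio `lam 0 / e`, are at most exponential in the total logarithmic size. -/
theorem exists_ellipsoidCovered {ξ η C : ℝ} (hξ : 0 < ξ) (hη : 0 < η) (hC : 1 ≤ C)
    (hball : ∀ A : Finset ℕ, ∃ T : Finset (ℕ → ℝ),
      (T.card : ℝ) ≤ C * Real.exp ((1 + ξ) * ξ) ^ A.card ∧ (∀ s ∈ T, ∀ j ∉ A, s j = 0) ∧
      ∀ x : ℕ → ℝ, ∑ j ∈ A, x j ^ 2 ≤ Real.exp ξ ^ 2 →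
        ∃ s ∈ T, ∑ j ∈ A, (x j - s j) ^ 2 ≤ 1)
    {lam : ℕ → ℝ} (hlam : ∀ j, 0 < lam j) (hanti : Antitone lam) (m : ℕ) {e P : ℝ} (he : 0 < e)
    (hP : max 0 (Real.log (lam 0 / e)) ≤ P) :
    ∃ c N : ℝ, c ≤ Real.exp η ∧
      EllipsoidCovered m lam (fun j => min (lam j) e) c N ∧
      N ≤ Real.exp ((P / (2 * ξ) + 1) * ((P / (2 * ξ) + 2) / η + 2) * C +
        (1 + ξ) * ∑ j ∈ Finset.range m, (max 0 (Real.log (lam j / e)) / 2 + ξ)) := by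
  have hP0 : 0 ≤ P := (le_max_left _ _).trans hP
  set L := ⌈P / (2 * ξ)⌉₊ with hL
  set M := ⌈((L : ℝ) + 1) / η⌉₊ with hM
  have hL1 : P / (2 * ξ) ≤ L := Nat.le_ceil _
  have hL2 : (L : ℝ) ≤ P / (2 * ξ) + 1 := (Nat.ceil_lt_add_one (by positivity)).le
  have hM1 : ((L : ℝ) + 1) / η ≤ M := Nat.le_ceil _
  have hM2 : (M : ℝ) ≤ ((L : ℝ) + 1) / η + 1 := (Nat.ceil_lt_add_one (by positivity)).le
  have hM0 : (0 : ℝ) < M := lt_of_lt_of_le (by positivity) hM1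
  have hR : 1 < Real.exp ξ := Real.one_lt_exp_iff.2 hξ
  have hcov := ellipsoidCovered_iterate hR hball hlam m he (M := M) (by exact_mod_cast hM0) L
  have htop : (fun j => min (lam j) ((Real.exp ξ ^ 2) ^ L * e)) = lam := by
    funext j
    apply min_eq_left
    refine (hanti (Nat.zero_le j)).trans ?_
    have h1 : Real.log (lam 0 / e) ≤ L * (2 * ξ) :=
      ((le_max_right _ _).trans hP).trans ((div_le_iff₀ (by positivity)).1 hL1)
    have h2 : lam 0 / e ≤ Real.exp (L * (2 * ξ)) := (Real.log_le_iff_le_exp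
      (div_pos (hlam 0) he)).1 h1
    rw [div_le_iff₀ he] at h2
    rwa [← Real.exp_nat_mul, ← Real.exp_nat_mul]
  rw [htop] at hcov
  refine ⟨_, _, ?_, hcov, ?_⟩
  · calc (1 + 1 / (M : ℝ)) ^ L ≤ Real.exp (1 / M) ^ L := by
          gcongr
          linarith [Real.add_one_le_exp (1 / (M : ℝ))]
      _ = Real.exp (L * (1 / M)) := (Real.exp_nat_mul _ _).symm
      _ ≤ Real.exp η := by
          gcongr
          rw [mul_one_div, div_le_iff₀ hM0]
          rw [div_le_iff₀ hη] at hM1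
          linarith
  · have hsum := sum_card_levels_le hR he hlam m L
    rw [Real.log_exp] at hsum
    rw [Real.exp_add]
    gcongr
    · calc (((M : ℝ) + 1) * C) ^ L ≤ Real.exp ((M + 1) * C) ^ L := by
            gcongr
            linarith [Real.add_one_le_exp (((M : ℝ) + 1) * C)]
        _ = Real.exp (L * ((M + 1) * C)) := (Real.exp_nat_mul _ _).symm
        _ ≤ _ := by
            refine Real.exp_le_exp.2 ?_
            have h1 : ((L : ℝ) + 1) / η ≤ (P / (2 * ξ) + 2) / η :=
              div_le_div_of_nonneg_right (by linarith) hη.le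
            have h2 : (M : ℝ) + 1 ≤ (P / (2 * ξ) + 2) / η + 2 := by linarith
            rw [mul_assoc]
            exact mul_le_mul hL2 (mul_le_mul_of_nonneg_right h2 (by linarith)) (by positivity)
              (by positivity)
    · rw [← Real.exp_nat_mul]
      refine Real.exp_le_exp.2 ?_
      calc _ ≤ (∑ j ∈ Finset.range m, (max 0 (Real.log (lam j / e)) / (2 * ξ) + 1)) *
            ((1 + ξ) * ξ) := by gcongr
        _ = _ := by
            rw [Finset.sum_mul, Finset.mul_sum]
            refine Finset.sum_congr rfl fun j _ => ?_
            field_simp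

theorem eventually_entropyNum_ellipsoid_le {H : Type*} [NormedAddCommGroup H]
    [InnerProductSpace ℝ H] [CompleteSpace H] {u : ℕ → H} (hu : Orthonormal ℝ u)
    (hb : 0 < b) (hφ_pos : ∀ x, s < x → 0 < φ x)
    (hφ_dec : ∀ x y, s < x → x ≤ y → φ y ≤ φ x)
    (hφ_rv : ∀ c : ℝ, 0 < c → Tendsto (fun x : ℝ => φ (c * x) / φ x) atTop (nhds (c ^ (-b))))
    {lam : ℕ → ℝ} (hlam : ∀ j, 0 < lam j) (hanti : Antitone lam)
    (hasymp : Tendsto (fun j : ℕ => lam j / φ j) atTop (nhds 1))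
    {a η : ℝ} (ha : b / 2 < a) (hη : 0 < η) :
    ∀ᶠ T : ℝ in atTop, ∀ n : ℕ, Real.exp (a * T) ≤ n →
      entropyNum (ellipsoid u lam) n ≤ √(Real.exp η * ((1 + η) * φ T)) := by
  obtain ⟨ξ, hξ, hgap⟩ : ∃ ξ : ℝ, 0 < ξ ∧ (1 + ξ) * (b / 2 + 2 * ξ) < a := by
    have hcont : Tendsto (fun ξ : ℝ => (1 + ξ) * (b / 2 + 2 * ξ)) (nhdsWithin 0 (Set.Ioi 0))
        (nhds (b / 2)) := by
      have : ContinuousAt (fun ξ : ℝ => (1 + ξ) * (b / 2 + 2 * ξ)) 0 := by fun_prop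
      have h := this.tendsto
      simp only [add_zero, one_mul, mul_zero] at h
      exact h.mono_left nhdsWithin_le_nhds
    obtain ⟨ξ, h1, h2⟩ := ((hcont.eventually_lt_const ha).and self_mem_nhdsWithin).exists
    exact ⟨ξ, h2, h1⟩
  obtain ⟨C, hC, hball⟩ := exists_finset_cover_coordinate_ball
    (R := Real.exp ξ) (D := Real.exp ((1 + ξ) * ξ)) (Real.one_lt_exp_iff.2 hξ)
    (Real.exp_lt_exp.2 (by nlinarith))
  obtain ⟨J, hJ1, hJs, hJ⟩ := exists_abs_log_eigenvalue_sub_le hb hφ_pos hφ_dec hφ_rv hlam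
    hasymp hξ
  obtain ⟨J', hJ'⟩ := eventually_atTop.1
    (hasymp.eventually_lt_const (show (1 : ℝ) < 1 + η by linarith))
  set A := Real.log (lam 0) - Real.log (lam J) + ξ with hA
  set g := a - (1 + ξ) * (b / 2 + 2 * ξ) with hg
  have hJ1' : (1 : ℝ) ≤ J := by exact_mod_cast hJ1
  have hlogJ : Real.log (lam J) ≤ Real.log (lam 0) :=
    Real.log_le_log (hlam J) (hanti (Nat.zero_le J))
  -- coefficients of the quadratic in `P = A + (b + ξ) log T`
  set q₂ := C / (4 * ξ ^ 2 * η) with hq₂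
  set q₁ := C * (3 / (2 * ξ * η) + 1 / ξ) + (1 + ξ) * (J / 2) with hq₁
  set q₀ := C * (2 / η + 2) + (1 + ξ) * (b / 2 + 2 * ξ) with hq₀
  filter_upwards [eventually_log_polynomial_le (q₀ + q₁ * A + q₂ * A ^ 2)
    (q₁ * (b + ξ) + 2 * q₂ * A * (b + ξ)) (q₂ * (b + ξ) ^ 2) (show 0 < g by linarith),
    eventually_ge_atTop (J : ℝ), eventually_ge_atTop (J' : ℝ)] with T hT hTJ hTJ' n hn
  have hT0 : 0 < T := by linarith
  have hTs : s < T := by linarith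
  have hφT := hφ_pos T hTs
  set e := (1 + η) * φ T with he_def
  have he : 0 < e := by positivity
  have heφ : Real.log (φ T) ≤ Real.log e := Real.log_le_log hφT (by nlinarith)
  set m := ⌈T⌉₊ with hm
  have hTm : T ≤ m := Nat.le_ceil T
  have hmT : (m : ℝ) ≤ T + 1 := (Nat.ceil_lt_add_one hT0.le).le
  set P := A + (b + ξ) * Real.log T with hP_def
  have hlogT : 0 ≤ Real.log T := Real.log_nonneg (by linarith)
  have hP0 : 0 ≤ P := by
    have : 0 ≤ (b + ξ) * Real.log T := by positivity
    linarith
  have hP1 : ∀ j, max 0 (Real.log (lam j / e)) ≤ P := by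
    intro j
    refine max_le hP0 ?_
    rw [Real.log_div (hlam j).ne' he.ne']
    have h1 := (abs_le.1 (hJ J T le_rfl hTJ)).2
    have h2 : Real.log (T / J) ≤ Real.log T :=
      Real.log_le_log (by positivity) (div_le_self hT0.le hJ1')
    have h3 : Real.log (lam j) ≤ Real.log (lam 0) :=
      Real.log_le_log (hlam j) (hanti (Nat.zero_le j))
    have h4 : (b + ξ) * Real.log (T / J) ≤ (b + ξ) * Real.log T := by gcongr
    linarith
  have hterm : ∀ j ∈ Finset.range m, max 0 (Real.log (lam j / e)) ≤
      (if j < J then P else 0) + ((b + ξ) * Real.log ((m : ℝ) / j) + ξ) := by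
    intro j hj
    have hjT : (j : ℝ) < T := Nat.lt_ceil.1 (Finset.mem_range.1 hj)
    have hz : 0 ≤ Real.log ((m : ℝ) / j) := by
      rcases Nat.eq_zero_or_pos j with rfl | hj0
      · simp
      · exact Real.log_nonneg ((one_le_div (by exact_mod_cast hj0)).2 (by linarith))
    have hz' : 0 ≤ (b + ξ) * Real.log ((m : ℝ) / j) := by positivity
    split_ifs with hjJ
    · linarith [hP1 j]
    · push Not at hjJ
      have hj0 : (0 : ℝ) < j := by
        have : (J : ℝ) ≤ j := by exact_mod_cast hjJ
        linarith
      refine max_le (by linarith) ?_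
      rw [Real.log_div (hlam j).ne' he.ne']
      have h1 := (abs_le.1 (hJ j T hjJ hjT.le)).2
      have h2 : Real.log (T / j) ≤ Real.log ((m : ℝ) / j) :=
        Real.log_le_log (by positivity) (by gcongr)
      have h4 : (b + ξ) * Real.log (T / j) ≤ (b + ξ) * Real.log ((m : ℝ) / j) := by gcongr
      linarith
  have hsumJ : ∑ j ∈ Finset.range m, (if j < J then P else 0) ≤ J * P := by
    rw [← Finset.sum_filter, Finset.sum_const, nsmul_eq_mul]
    gcongr
    calc _ ≤ (Finset.range J).card := Finset.card_le_card fun j hj => by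
            simpa using (Finset.mem_filter.1 hj).2
      _ = J := Finset.card_range J
  have hsum : ∑ j ∈ Finset.range m, (max 0 (Real.log (lam j / e)) / 2 + ξ) ≤
      J / 2 * P + (b / 2 + 2 * ξ) * (T + 1) := by
    have h1 := Finset.sum_le_sum hterm
    rw [Finset.sum_add_distrib, Finset.sum_add_distrib, ← Finset.mul_sum, Finset.sum_const,
      Finset.card_range, nsmul_eq_mul] at h1
    rw [Finset.sum_add_distrib, ← Finset.sum_div, Finset.sum_const, Finset.card_range,
      nsmul_eq_mul]
    have h2 : (b + ξ) * ∑ j ∈ Finset.range m, Real.log ((m : ℝ) / j) ≤ (b + ξ) * m := by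
      gcongr
      exact sum_range_log_div_le m
    have h3 : (b / 2 + 2 * ξ) * m ≤ (b / 2 + 2 * ξ) * (T + 1) := by gcongr
    linarith
  obtain ⟨c, N, hc, hcov, hN⟩ := exists_ellipsoidCovered hξ hη hC hball hlam hanti m he (hP1 0)
  have htail : ∀ j, m ≤ j → lam j ≤ e := by
    intro j hj
    have hTj : T ≤ j := hTm.trans (by exact_mod_cast hj)
    have h1 := hJ' j (by exact_mod_cast hTJ'.trans hTj)
    rw [div_lt_iff₀ (hφ_pos _ (by linarith))] at h1
    refine h1.le.trans ?_
    exact mul_le_mul_of_nonneg_left (hφ_dec T j hTs hTj) (by linarith)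
  refine (entropyNum_ellipsoid_le hu hlam he htail hcov (hN.trans (le_trans ?_ hn))).trans ?_
  · refine Real.exp_le_exp.2 ?_
    have hquad : (P / (2 * ξ) + 1) * ((P / (2 * ξ) + 2) / η + 2) * C +
        (1 + ξ) * (J / 2 * P + (b / 2 + 2 * ξ) * (T + 1)) =
        q₀ + q₁ * P + q₂ * P ^ 2 + (a - g) * T := by
      rw [hq₀, hq₁, hq₂, hg]
      field_simp
      ring
    have h1 : (1 + ξ) * ∑ j ∈ Finset.range m, (max 0 (Real.log (lam j / e)) / 2 + ξ) ≤
      (1 + ξ) * (J / 2 * P + (b / 2 + 2 * ξ) * (T + 1)) := by gcongr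
    have h2 : q₀ + q₁ * P + q₂ * P ^ 2 ≤ g * T := by
      refine le_trans (le_of_eq ?_) hT
      rw [hP_def]
      ring
    linarith
  · gcongr

theorem eventually_le_entropyNum_ellipsoid {H : Type*} [NormedAddCommGroup H]
    [InnerProductSpace ℝ H] [CompleteSpace H] {u : ℕ → H} (hu : Orthonormal ℝ u)
    (hb : 0 < b) (hφ_pos : ∀ x, s < x → 0 < φ x)
    (hφ_dec : ∀ x y, s < x → x ≤ y → φ y ≤ φ x)
    (hφ_rv : ∀ c : ℝ, 0 < c → Tendsto (fun x : ℝ => φ (c * x) / φ x) atTop (nhds (c ^ (-b))))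
    {lam : ℕ → ℝ} (hlam : ∀ j, 0 < lam j) (hanti : Antitone lam)
    (hasymp : Tendsto (fun j : ℕ => lam j / φ j) atTop (nhds 1)) {ζ : ℝ} (hζ : 0 < ζ) :
    ∀ᶠ m : ℕ in atTop, ∀ n : ℕ, 1 ≤ n → Real.log n ≤ b / 2 * m →
      √(Real.exp (-ζ) * φ m) ≤ entropyNum (ellipsoid u lam) n := by
  set δ := min (ζ / 4) b with hδ
  have hδ0 : 0 < δ := lt_min (by linarith) hb
  have hδζ : δ ≤ ζ / 4 := min_le_left _ _
  have hδb : δ ≤ b := min_le_right _ _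
  obtain ⟨J, hJ1, hJs, hJ⟩ := exists_abs_log_eigenvalue_sub_le hb hφ_pos hφ_dec hφ_rv hlam
    hasymp hδ0
  have hJ1' : (1 : ℝ) ≤ J := by exact_mod_cast hJ1
  have hlogJ : 0 ≤ Real.log J := Real.log_nonneg hJ1'
  filter_upwards [tendsto_natCast_atTop_atTop.eventually
    (eventually_log_polynomial_le (b + J * (b * Real.log J)) b 0 (half_pos hζ)),
    eventually_ge_atTop J] with m hm hmJ n hn hlogn
  have hmJ' : (J : ℝ) ≤ m := by exact_mod_cast hmJ
  have hm0 : (0 : ℝ) < m := by linarith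
  have hφm : 0 < φ m := hφ_pos _ (by linarith)
  have hterm : ∀ j ∈ Finset.range m,
      (b - δ) * Real.log ((m : ℝ) / j) - δ - (if j < J then b * Real.log J else 0) ≤
        Real.log (lam j) - Real.log (φ m) := by
    intro j hj
    have hjm : (j : ℝ) ≤ m := by exact_mod_cast (Finset.mem_range.1 hj).le
    split_ifs with hjJ
    · have h1 := (abs_le.1 (hJ J m le_rfl hmJ')).1
      have h2 : Real.log (lam J) ≤ Real.log (lam j) := Real.log_le_log (hlam J) (hanti hjJ.le)
      have h3 : Real.log ((m : ℝ) / j) ≤ Real.log ((m : ℝ) / J) + Real.log J := by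
        rw [Real.log_div hm0.ne' (show (J : ℝ) ≠ 0 by linarith), sub_add_cancel]
        rcases Nat.eq_zero_or_pos j with rfl | hj0
        · simpa using Real.log_nonneg (by linarith)
        · have hj1 : (1 : ℝ) ≤ j := by exact_mod_cast hj0
          exact Real.log_le_log (by positivity) (div_le_self hm0.le hj1)
      have h4 := mul_le_mul_of_nonneg_left h3 (sub_nonneg.2 hδb)
      have h5 : 0 ≤ δ * Real.log J := by positivity
      linarith
    · push Not at hjJ
      have h1 := (abs_le.1 (hJ j m hjJ hjm)).1
      linarith
  have hsumJ : ∑ j ∈ Finset.range m, (if j < J then b * Real.log J else 0) ≤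
      J * (b * Real.log J) := by
    rw [← Finset.sum_filter, Finset.sum_const, nsmul_eq_mul]
    gcongr
    calc _ ≤ (Finset.range J).card := Finset.card_le_card fun j hj => by
            simpa using (Finset.mem_filter.1 hj).2
      _ = J := Finset.card_range J
  have hsum : (b - ζ) * m + m * Real.log (φ m) ≤ ∑ j ∈ Finset.range m, Real.log (lam j) := by
    have h1 := Finset.sum_le_sum hterm
    rw [Finset.sum_sub_distrib, Finset.sum_sub_distrib, Finset.sum_sub_distrib, ← Finset.mul_sum,
      Finset.sum_const, Finset.sum_const, Finset.card_range, nsmul_eq_mul, nsmul_eq_mul] at h1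
    have h2 := mul_le_mul_of_nonneg_left (le_sum_range_log_div (hJ1.trans hmJ))
      (sub_nonneg.2 hδb)
    have h3 : 0 ≤ δ * Real.log m := mul_nonneg hδ0.le (Real.log_nonneg (by linarith))
    have h4 : δ * m ≤ ζ / 4 * m := by gcongr
    linarith
  refine le_entropyNum_ellipsoid hu hlam hanti (hJ1.trans hmJ) hn ?_
  have hn0 : (0 : ℝ) < n := by exact_mod_cast hn
  have hr : 0 < √(Real.exp (-ζ) * φ m) := Real.sqrt_pos.2 (by positivity)
  rw [← Real.log_le_log_iff (by positivity)
    (Finset.prod_pos fun j _ => Real.sqrt_pos.2 (hlam j)),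
    Real.log_mul hn0.ne' (by positivity), Real.log_pow, Real.log_sqrt (by positivity),
    Real.log_mul (by positivity) hφm.ne', Real.log_exp,
    Real.log_prod fun j _ => (Real.sqrt_pos.2 (hlam j)).ne']
  rw [Finset.sum_congr rfl fun j _ => Real.log_sqrt (hlam j).le, ← Finset.sum_div]
  linarith

/-- Regular variation along `log n`, normalised by the asymptotic constant. -/
theorem tendsto_sqrt_regularlyVarying_log
    (hφ_rv : ∀ c : ℝ, 0 < c → Tendsto (fun x : ℝ => φ (c * x) / φ x) atTop (nhds (c ^ (-b))))
    {a c d : ℝ} (ha : 0 < a) (hc : 0 < c) :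
    Tendsto (fun n : ℕ => √(d * φ (c * Real.log n) / (a ^ b * φ (Real.log n)))) atTop
      (nhds √(d * (c * a) ^ (-b))) := by
  have h := (hφ_rv c hc).comp (Real.tendsto_log_atTop.comp tendsto_natCast_atTop_atTop)
  have h1 := (h.const_mul (d * a ^ (-b))).sqrt
  rw [mul_assoc, ← Real.mul_rpow ha.le hc.le, mul_comm a c] at h1
  refine h1.congr fun n => ?_
  simp only [Function.comp_apply]
  rw [Real.rpow_neg ha.le]
  congr 1
  have : a ^ b ≠ 0 := (Real.rpow_pos_of_pos ha b).ne'
  rw [mul_comm (a ^ b), ← div_div, mul_div_assoc]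
  ring

theorem tendsto_entropyNum_ellipsoid {H : Type*} [NormedAddCommGroup H]
    [InnerProductSpace ℝ H] [CompleteSpace H] {u : ℕ → H} (hu : Orthonormal ℝ u)
    (hb : 0 < b) (hφ_pos : ∀ x, s < x → 0 < φ x)
    (hφ_dec : ∀ x y, s < x → x ≤ y → φ y ≤ φ x)
    (hφ_rv : ∀ c : ℝ, 0 < c → Tendsto (fun x : ℝ => φ (c * x) / φ x) atTop (nhds (c ^ (-b))))
    {lam : ℕ → ℝ} (hlam : ∀ j, 0 < lam j) (hanti : Antitone lam)
    (hasymp : Tendsto (fun j : ℕ => lam j / φ j) atTop (nhds 1)) :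
    Tendsto (fun n : ℕ => entropyNum (ellipsoid u lam) n / √((b / 2) ^ b * φ (Real.log n)))
      atTop (nhds 1) := by
  have hα : 0 < b / 2 := half_pos hb
  have hlog : Tendsto (fun n : ℕ => Real.log n) atTop atTop :=
    Real.tendsto_log_atTop.comp tendsto_natCast_atTop_atTop
  have hpos : ∀ᶠ n : ℕ in atTop, 0 < (b / 2) ^ b * φ (Real.log n) := by
    filter_upwards [hlog.eventually_gt_atTop s] with n hn
    exact mul_pos (Real.rpow_pos_of_pos hα b) (hφ_pos _ hn)
  refine tendsto_order.2 ⟨fun r hr => ?_, fun r hr => ?_⟩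
  · obtain ⟨x, hx, hx0⟩ : ∃ x : ℝ, r < √(Real.exp (-x) * (1 + x) ^ (-b)) ∧ 0 < x := by
      have hcont : ContinuousAt (fun x : ℝ => √(Real.exp (-x) * (1 + x) ^ (-b))) 0 := by
        refine ContinuousAt.sqrt (ContinuousAt.mul (by fun_prop) ?_)
        exact ContinuousAt.rpow_const (by fun_prop) (Or.inl (by norm_num))
      have h := hcont.tendsto
      simp only [neg_zero, Real.exp_zero, add_zero, Real.one_rpow, one_mul, Real.sqrt_one] at h
      exact (((h.mono_left nhdsWithin_le_nhds).eventually_const_lt hr).and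
        (self_mem_nhdsWithin (s := Set.Ioi (0 : ℝ)))).exists
    set c := (1 + x) / (b / 2) with hc
    have hc0 : 0 < c := by positivity
    have hlim := tendsto_sqrt_regularlyVarying_log hφ_rv (d := Real.exp (-x)) hα hc0
    rw [show c * (b / 2) = 1 + x by rw [hc]; field_simp] at hlim
    have hceil : Tendsto (fun n : ℕ => ⌈Real.log n / (b / 2)⌉₊) atTop atTop :=
      tendsto_nat_ceil_atTop.comp (hlog.atTop_div_const hα)
    filter_upwards [hlim.eventually_const_lt hx, hpos, eventually_ge_atTop 1,
      hceil.eventually (eventually_le_entropyNum_ellipsoid hu hb hφ_pos hφ_dec hφ_rv hlam hanti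
        hasymp hx0), hceil.eventually_gt_atTop ⌈s⌉₊,
      hlog.eventually_ge_atTop (b / 2 / x)] with n h1 h2 hn h3 h4 h5
    set m := ⌈Real.log n / (b / 2)⌉₊ with hm
    have hm1 : Real.log n / (b / 2) ≤ m := Nat.le_ceil _
    have hlogn : 0 ≤ Real.log n := Real.log_natCast_nonneg n
    have hm2 : (m : ℝ) ≤ c * Real.log n := by
      have h6 := (Nat.ceil_lt_add_one (show 0 ≤ Real.log n / (b / 2) by positivity)).le
      have h7 : 1 ≤ x * Real.log n / (b / 2) := by
        rw [le_div_iff₀ hα]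
        rw [div_le_iff₀ hx0] at h5
        linarith
      calc (m : ℝ) ≤ Real.log n / (b / 2) + 1 := h6
        _ ≤ Real.log n / (b / 2) + x * Real.log n / (b / 2) := by linarith
        _ = c * Real.log n := by rw [hc]; ring
    have hsm : s < m := (Nat.le_ceil s).trans_lt (by exact_mod_cast h4)
    have h8 := h3 n hn (by rw [div_le_iff₀ hα] at hm1; linarith)
    refine h1.trans_le ?_
    rw [Real.sqrt_div' _ h2.le]
    refine div_le_div_of_nonneg_right (le_trans (Real.sqrt_le_sqrt ?_) h8) (Real.sqrt_nonneg _)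
    exact mul_le_mul_of_nonneg_left (hφ_dec _ _ hsm hm2) (Real.exp_pos _).le
  · obtain ⟨x, hx, hx0⟩ : ∃ x : ℝ,
        √(Real.exp x * (1 + x) * (1 / (1 + x)) ^ (-b)) < r ∧ 0 < x := by
      have hcont : ContinuousAt
          (fun x : ℝ => √(Real.exp x * (1 + x) * (1 / (1 + x)) ^ (-b))) 0 := by
        refine ContinuousAt.sqrt (ContinuousAt.mul (by fun_prop) ?_)
        refine ContinuousAt.rpow_const (ContinuousAt.div (by fun_prop) (by fun_prop) ?_)
          (Or.inl ?_) <;> norm_num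
      have h := hcont.tendsto
      simp only [Real.exp_zero, add_zero, Real.one_rpow, one_mul, Real.sqrt_one, div_one] at h
      exact (((h.mono_left nhdsWithin_le_nhds).eventually_lt_const hr).and
        (self_mem_nhdsWithin (s := Set.Ioi (0 : ℝ)))).exists
    set a := b / 2 * (1 + x) with ha
    have ha0 : 0 < a := by positivity
    have hlim := tendsto_sqrt_regularlyVarying_log hφ_rv (d := Real.exp x * (1 + x)) hα
      (inv_pos.2 ha0)
    rw [show a⁻¹ * (b / 2) = 1 / (1 + x) by rw [ha]; field_simp] at hlim
    have hT : Tendsto (fun n : ℕ => a⁻¹ * Real.log n) atTop atTop :=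
      hlog.const_mul_atTop (inv_pos.2 ha0)
    filter_upwards [hlim.eventually_lt_const hx, hpos, eventually_ge_atTop 1,
      hT.eventually (eventually_entropyNum_ellipsoid_le hu hb hφ_pos hφ_dec hφ_rv hlam hanti
        hasymp (a := a) (by nlinarith) hx0)] with n h1 h2 hn h3
    have h4 := h3 n (by
      rw [mul_inv_cancel_left₀ ha0.ne', Real.exp_log (by exact_mod_cast hn)])
    refine lt_of_le_of_lt ?_ h1
    rw [Real.sqrt_div' _ h2.le, mul_assoc]
    exact div_le_div_of_nonneg_right h4 (Real.sqrt_nonneg _)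

end Asymptotics

/-- Sharp asymptotics of the entropy numbers of the unit ball `U_X` of the Cameron–Martin
space of a centered Gaussian random vector with regularly varying covariance eigenvalues:
`e_n(U_X) ~ (b/2)^{b/2} φ(log n)^{1/2}`. -/
theorem entropy_of_cameron_martin_ball
    {H : Type*} [NormedAddCommGroup H] [InnerProductSpace ℝ H] [CompleteSpace H]
    [TopologicalSpace.SeparableSpace H]
    {Ω : Type*} [MeasurableSpace Ω] (P : Measure Ω) [IsProbabilityMeasure P]
    (X : Ω → H)
    (hXmeas : AEStronglyMeasurable X P)
    (hXint : Integrable (fun ω => ‖X ω‖ ^ 2) P)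
    -- `X` is a centered Gaussian random vector
    (hGauss : ∀ y : H, ∃ v : ℝ≥0,
      Measure.map (fun ω => ⟪y, X ω⟫) P = gaussianReal 0 v)
    -- `lam` enumerates (in nonincreasing order, with multiplicity) the nonzero eigenvalues
    -- of the covariance operator `C_X y = E(⟪y,X⟫ X)`, with orthonormal eigenvectors `u`;
    -- all `lam j > 0`, so the Cameron–Martin space is infinite dimensional
    (u : ℕ → H) (hu : Orthonormal ℝ u)
    (lam : ℕ → ℝ) (hlam_pos : ∀ j, 0 < lam j) (hlam_anti : Antitone lam)
    (heig : ∀ j, ∀ y : H, ∫ ω, ⟪u j, X ω⟫ * ⟪y, X ω⟫ ∂P = lam j * ⟪u j, y⟫)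
    -- the eigenvectors `u` span the support of the law of `X` (so that `lam` lists *all*
    -- nonzero eigenvalues and `supp(P_X)` is the closed span of the `u j`)
    (hspan : ∀ᵐ ω ∂P, X ω ∈ closure (Submodule.span ℝ (Set.range u) : Set H))
    -- `φ : (s,∞) → (0,∞)` is decreasing and regularly varying at infinity of index `-b`
    (s b : ℝ) (hs : 0 ≤ s) (hb : 1 < b)
    (φ : ℝ → ℝ) (hφ_pos : ∀ x, s < x → 0 < φ x)
    (hφ_dec : ∀ x y, s < x → x ≤ y → φ y ≤ φ x)
    (hφ_rv : ∀ c : ℝ, 0 < c →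
      Tendsto (fun x : ℝ => φ (c * x) / φ x) atTop (nhds (c ^ (-b))))
    -- `λ_j ~ φ(j)` as `j → ∞`
    (hasymp : Tendsto (fun j : ℕ => lam j / φ j) atTop (nhds 1))
    -- `U_X` is the closed unit ball of the Cameron–Martin space:
    -- `U_X = {x ∈ supp(P_X) : Σ_j ⟨x,u_j⟩²/λ_j ≤ 1}`
    (U : Set H)
    (hU : U = {x ∈ closure (Submodule.span ℝ (Set.range u) : Set H) |
        Summable (fun j => ⟪x, u j⟫ ^ 2 / lam j) ∧ ∑' j, ⟪x, u j⟫ ^ 2 / lam j ≤ 1}) :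
    Tendsto (fun n : ℕ =>
        entropyNum U n / ((b / 2) ^ (b / 2) * (φ (Real.log n)) ^ (1/2 : ℝ)))
      atTop (nhds 1) := by
  have h := tendsto_entropyNum_ellipsoid hu (by linarith) hφ_pos hφ_dec hφ_rv hlam_pos
    hlam_anti hasymp
  have hlog : Tendsto (fun n : ℕ => Real.log n) atTop atTop :=
    Real.tendsto_log_atTop.comp tendsto_natCast_atTop_atTop
  refine h.congr' ?_
  filter_upwards [hlog.eventually_gt_atTop s] with n hn
  have hUe : U = ellipsoid u lam := hU
  have hα : 0 ≤ b / 2 := by linarith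
  rw [hUe, Real.sqrt_mul (Real.rpow_nonneg hα b), Real.sqrt_eq_rpow, Real.sqrt_eq_rpow,
    ← Real.rpow_mul hα, mul_one_div]
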